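/- arXiv:1212.5942 — 3 statements merged into one kernel-verified Lean document; each statement's English description precedes it below -/
import Mathlib

section
/- Let H be a real Hilbert space, V a closed vector subspace of H, A : H → 2^H maximally monotone, B : H → H β-cocoercive on V for some β > 0, and assume the set Z of solutions of 0 ∈ Ax + Bx + N_V x is nonempty. Let γ ∈ (0, 2β), set α = max{2/3, 2γ/(γ+2β)}, let (λ_n) be a sequence in (0, 1/α), let (a_n) and (b_n) be sequences in H with Σ_n λ_n(1−αλ_n) = +∞ and Σ_n λ_n(‖a_n‖+‖b_n‖) < +∞. Let z_0 ∈ H and for every n ∈ ℕ set x_n = P_V z_n, y_n = (x_n − z_n)/γ, s_n = x_n − γP_V(Bx_n + a_n) + γy_n, p_n = J_{γA} s_n + b_n, and z_{n+1} = z_n + λ_n(p_n − x_n). Then x_n ∈ V and y_n ∈ V⊥ for all n, and there exist x̄ ∈ Z and ȳ ∈ V⊥ ∩ (Ax̄ + P_V(Bx̄)) such that x_n converges weakly to x̄ and y_n converges weakly to ȳ. -/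
open Filter Topology
open scoped RealInnerProductSpace Pointwise

variable {H : Type*} [NormedAddCommGroup H] [InnerProductSpace ℝ H] [CompleteSpace H]

/-- A set-valued operator `A : H → 2^H` is monotone. -/
def IsMonotoneOp (A : H → Set H) : Prop :=
  ∀ x y u v : H, u ∈ A x → v ∈ A y → 0 ≤ ⟪x - y, u - v⟫

/-- A set-valued operator is maximally monotone: it is monotone and its graph is not
properly contained in the graph of any monotone operator. -/
def IsMaxMonotoneOp (A : H → Set H) : Prop :=
  IsMonotoneOp A ∧ ∀ x u : H, (∀ y v : H, v ∈ A y → 0 ≤ ⟪x - y, u - v⟫) → u ∈ A x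

/-- The normal cone to a closed vector subspace `V`: it maps `x ∈ V` to `Vᗮ`
and `x ∉ V` to `∅`. -/
def normalConeSub (V : Submodule ℝ H) : H → Set H :=
  fun x => {w | x ∈ V ∧ w ∈ Vᗮ}

/-- `z n` converges weakly to `w`. -/
def WeakLim (z : ℕ → H) (w : H) : Prop :=
  ∀ y : H, Tendsto (fun n => ⟪z n, y⟫) atTop (nhds ⟪w, y⟫)

/-- The partial inverse of a set-valued operator `M` with respect to a subspace with
orthogonal projection `P` (so that `P_{V⊥} = id - P`):
`y ∈ M_V x ↔ P_V y + P_{V⊥} x ∈ M (P_V x + P_{V⊥} y)`. -/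
def partialInvOp (P : H → H) (M : H → Set H) : H → Set H :=
  fun x => {y | P y + (x - P x) ∈ M (P x + (y - P y))}

/-- Quasi-Fejér sequences of reals converge. -/
theorem aux_quasi_fejer (r ε : ℕ → ℝ) (hr : ∀ n, 0 ≤ r n) (he : ∀ n, 0 ≤ ε n)
    (hsum : Summable ε) (h : ∀ n, r (n + 1) ≤ r n + ε n) : ∃ L, Tendsto r atTop (𝓝 L) := by
  have hanti : Antitone (fun n => r n - ∑ k ∈ Finset.range n, ε k) := by
    apply antitone_nat_of_succ_le
    intro n
    rw [Finset.sum_range_succ]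
    linarith [h n]
  have hbdd : BddBelow (Set.range (fun n => r n - ∑ k ∈ Finset.range n, ε k)) := by
    refine ⟨-∑' k, ε k, ?_⟩
    rintro _ ⟨n, rfl⟩
    have := hsum.sum_le_tsum (Finset.range n) (fun i _ => he i)
    have := hr n
    simp only
    linarith
  have h1 := tendsto_atTop_ciInf hanti hbdd
  have h2 := hsum.hasSum.tendsto_sum_nat
  have h3 := h1.add h2
  refine ⟨_, h3.congr ?_⟩
  intro n
  simp

/-- Bounded sequences have weak limits along ultrafilters. -/
theorem aux_weak_ultra (z : ℕ → H) (M : ℝ) (hM : ∀ n, ‖z n‖ ≤ M) (U : Ultrafilter ℕ) :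
    ∃ w : H, ∀ y : H, Tendsto (fun n => ⟪z n, y⟫) U (𝓝 ⟪w, y⟫) := by
  have hb : ∀ y n, ‖⟪z n, y⟫‖ ≤ M * ‖y‖ := fun y n =>
    (norm_inner_le_norm _ _).trans (mul_le_mul_of_nonneg_right (hM n) (norm_nonneg _))
  have hex : ∀ y : H, ∃ l : ℝ, Tendsto (fun n => ⟪z n, y⟫) U (𝓝 l) := by
    intro y
    have hc := isCompact_iff_ultrafilter_le_nhds.1 (isCompact_closedBall (0 : ℝ) (M * ‖y‖))
      (U.map (fun n => ⟪z n, y⟫)) (by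
        rw [le_principal_iff]
        refine Filter.mem_map.2 (Filter.univ_mem' ?_)
        intro n
        simpa using hb y n)
    obtain ⟨l, _, hl⟩ := hc
    exact ⟨l, hl⟩
  choose f hf using hex
  have hadd : ∀ u v, f (u + v) = f u + f v := fun u v =>
    tendsto_nhds_unique (hf (u + v)) (((hf u).add (hf v)).congr (fun n => (inner_add_right _ _ _).symm))
  have hsmul : ∀ (c : ℝ) v, f (c • v) = c • f v := fun c v =>
    tendsto_nhds_unique (hf (c • v)) (((hf v).const_mul c).congr
      (fun n => (real_inner_smul_right _ _ _).symm))
  let F : H →ₗ[ℝ] ℝ := { toFun := f, map_add' := hadd, map_smul' := hsmul }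
  let G : H →L[ℝ] ℝ := F.mkContinuous M (fun y =>
    le_of_tendsto (hf y).norm (Filter.Eventually.of_forall (hb y)))
  refine ⟨(InnerProductSpace.toDual ℝ H).symm G, fun y => ?_⟩
  rw [InnerProductSpace.toDual_symm_apply]
  exact hf y

/-- Krasnoselskii-Mann iteration with errors, for a cocoercive operator. -/
theorem aux_km (E : H → H) (κ : ℝ) (hκ : 0 < κ)
    (hE : ∀ u v, κ * ‖E u - E v‖ ^ 2 ≤ ⟪u - v, E u - E v⟫)
    (hz0 : ∃ w, E w = 0) (lam : ℕ → ℝ) (hl0 : ∀ n, 0 < lam n) (hl1 : ∀ n, lam n < 2 * κ)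
    (hdiv : ¬ Summable (fun n => lam n * (2 * κ - lam n)))
    (e z : ℕ → H) (herr : Summable (fun n => lam n * ‖e n‖))
    (hz : ∀ n, z (n + 1) = z n - lam n • E (z n) + lam n • e n) :
    ∃ w, E w = 0 ∧ WeakLim z w := by
  have hεnn : ∀ n, 0 ≤ lam n * ‖e n‖ := fun n => mul_nonneg (hl0 n).le (norm_nonneg _)
  have hεn : ∀ n, ‖z (n + 1) - (z n - lam n • E (z n))‖ = lam n * ‖e n‖ := by
    intro n
    rw [hz n, add_sub_cancel_left, norm_smul, Real.norm_of_nonneg (hl0 n).le]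
  -- one exact step
  have hstep : ∀ w, E w = 0 → ∀ n, ‖z n - lam n • E (z n) - w‖ ^ 2 ≤
      ‖z n - w‖ ^ 2 - lam n * (2 * κ - lam n) * ‖E (z n)‖ ^ 2 := by
    intro w hw n
    have h1 := hE (z n) w
    rw [hw, sub_zero] at h1
    have h2 : z n - lam n • E (z n) - w = (z n - w) - lam n • E (z n) := by abel
    rw [h2, norm_sub_sq_real, norm_smul, Real.norm_of_nonneg (hl0 n).le, real_inner_smul_right]
    have h3 := mul_le_mul_of_nonneg_left h1 (hl0 n).le
    nlinarith
  have hcoef : ∀ n, 0 ≤ lam n * (2 * κ - lam n) := fun n =>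
    mul_nonneg (hl0 n).le (by linarith [hl1 n])
  have hstep' : ∀ w, E w = 0 → ∀ n, ‖z n - lam n • E (z n) - w‖ ≤ ‖z n - w‖ := by
    intro w hw n
    have h1 := hstep w hw n
    have h2 := mul_nonneg (hcoef n) (sq_nonneg ‖E (z n)‖)
    exact le_of_sq_le_sq (by linarith) (norm_nonneg _)
  have hfej : ∀ w, E w = 0 → ∀ n, ‖z (n + 1) - w‖ ≤ ‖z n - lam n • E (z n) - w‖ + lam n * ‖e n‖ := by
    intro w hw n
    have h2 : z (n + 1) - w = (z n - lam n • E (z n) - w) +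
      (z (n + 1) - (z n - lam n • E (z n))) := by abel
    rw [← hεn n]
    calc _ = ‖(z n - lam n • E (z n) - w) + (z (n + 1) - (z n - lam n • E (z n)))‖ := by rw [← h2]
      _ ≤ _ := norm_add_le _ _
  have hconv : ∀ w, E w = 0 → ∃ L, Tendsto (fun n => ‖z n - w‖) atTop (𝓝 L) := by
    intro w hw
    refine aux_quasi_fejer _ _ (fun n => norm_nonneg _) hεnn herr ?_
    intro n
    linarith [hfej w hw n, hstep' w hw n]
  obtain ⟨w, hw⟩ := hz0
  obtain ⟨M, hM⟩ : ∃ M, ∀ n, ‖z n - w‖ ≤ M := by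
    obtain ⟨L, hL⟩ := hconv w hw
    obtain ⟨M, hM⟩ := hL.bddAbove_range
    exact ⟨M, fun n => hM ⟨n, rfl⟩⟩
  have hM0 : 0 ≤ M := (norm_nonneg _).trans (hM 0)
  -- summability
  have hsum : Summable (fun n => lam n * (2 * κ - lam n) * ‖E (z n)‖ ^ 2) := by
    have hb : ∀ n, lam n * (2 * κ - lam n) * ‖E (z n)‖ ^ 2 ≤
        ‖z n - w‖ ^ 2 - ‖z (n + 1) - w‖ ^ 2 + 2 * M * (lam n * ‖e n‖) := by
      intro n
      have h1 := hstep w hw n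
      have h2 := hstep' w hw n
      have h3 := hfej w hw n
      have h4 := hM n
      have h5 := hM (n + 1)
      have h6 := norm_nonneg (z (n + 1) - w)
      have h7 := norm_nonneg (z n - lam n • E (z n) - w)
      have h8 := hεnn n
      have : ‖z (n + 1) - w‖ ^ 2 - ‖z n - lam n • E (z n) - w‖ ^ 2 ≤ 2 * M * (lam n * ‖e n‖) := by
        have e1 : ‖z (n + 1) - w‖ ^ 2 - ‖z n - lam n • E (z n) - w‖ ^ 2 =
          (‖z (n + 1) - w‖ + ‖z n - lam n • E (z n) - w‖) *
          (‖z (n + 1) - w‖ - ‖z n - lam n • E (z n) - w‖) := by ring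
        rw [e1]
        exact (mul_le_mul_of_nonneg_left (by linarith) (by linarith)).trans
          (mul_le_mul_of_nonneg_right (by linarith) h8)
      linarith
    refine summable_of_sum_range_le (c := ‖z 0 - w‖ ^ 2 + 2 * M * ∑' n, lam n * ‖e n‖)
      (fun n => mul_nonneg (hcoef n) (sq_nonneg _)) ?_
    intro n
    have h1 := Finset.sum_le_sum (fun i (_ : i ∈ Finset.range n) => hb i)
    rw [Finset.sum_add_distrib, Finset.sum_range_sub', ← Finset.mul_sum] at h1
    have h2 := herr.sum_le_tsum (Finset.range n) (fun i _ => hεnn i)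
    have h3 := mul_le_mul_of_nonneg_left h2 (by linarith : 0 ≤ 2 * M)
    nlinarith [sq_nonneg ‖z n - w‖]
  -- Lipschitz
  have hLip : ∀ u v, ‖E u - E v‖ ≤ κ⁻¹ * ‖u - v‖ := by
    intro u v
    have h1 := (hE u v).trans (real_inner_le_norm _ _)
    rcases (norm_nonneg (E u - E v)).eq_or_lt with h0 | h0
    · rw [← h0]; positivity
    · rw [inv_mul_eq_div, le_div_iff₀ hκ]
      nlinarith
  have hEdec : ∀ n, ‖E (z (n + 1))‖ ≤ ‖E (z n)‖ + κ⁻¹ * (lam n * ‖e n‖) := by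
    intro n
    have h1 : ‖E (z n - lam n • E (z n))‖ ≤ ‖E (z n)‖ := by
      have h2 := hE (z n) (z n - lam n • E (z n))
      rw [sub_sub_cancel, real_inner_smul_left] at h2
      set d := E (z n) - E (z n - lam n • E (z n)) with hd
      have h3 : E (z n - lam n • E (z n)) = E (z n) - d := by rw [hd]; abel
      have h4 : lam n * ‖d‖ ^ 2 ≤ lam n * (2 * ⟪E (z n), d⟫) := by
        nlinarith [sq_nonneg ‖d‖, hl1 n]
      have h5 := le_of_mul_le_mul_left h4 (hl0 n)
      rw [h3]
      apply le_of_sq_le_sq _ (norm_nonneg _)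
      rw [norm_sub_sq_real]
      linarith
    have h2 := hLip (z (n + 1)) (z n - lam n • E (z n))
    rw [hεn n] at h2
    have h3 := norm_le_norm_add_norm_sub (E (z n - lam n • E (z n))) (E (z (n + 1)))
    rw [norm_sub_rev] at h3
    linarith
  obtain ⟨L, hL⟩ := aux_quasi_fejer _ _ (fun n => norm_nonneg (E (z n)))
    (fun n => mul_nonneg (inv_nonneg.2 hκ.le) (hεnn n)) (herr.mul_left _) hEdec
  have hL0 : L = 0 := by
    by_contra hne
    have hLn : 0 ≤ L := ge_of_tendsto' hL (fun n => norm_nonneg _)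
    have hLp : 0 < L := lt_of_le_of_ne hLn (Ne.symm hne)
    apply hdiv
    have hev := (hL.pow 2).eventually (lt_mem_nhds (by nlinarith : L ^ 2 / 2 < L ^ 2))
    have hs2 := hsum.mul_left (2 / L ^ 2)
    refine hs2.of_norm_bounded_eventually_nat ?_
    filter_upwards [hev] with n hn
    rw [Real.norm_of_nonneg (hcoef n)]
    have h1 := mul_le_mul_of_nonneg_left hn.le (hcoef n)
    have h2 := mul_le_mul_of_nonneg_left h1 (by positivity : 0 ≤ 2 / L ^ 2)
    refine le_trans (le_of_eq ?_) h2
    field_simp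
  rw [hL0] at hL
  have hEz : Tendsto (fun n => E (z n)) atTop (𝓝 0) := tendsto_zero_iff_norm_tendsto_zero.2 hL
  have hzb : ∀ n, ‖z n‖ ≤ M + ‖w‖ := by
    intro n
    have := norm_le_norm_add_norm_sub w (z n)
    rw [norm_sub_rev] at this
    linarith [hM n]
  -- demiclosedness
  have hdemi : ∀ U : Ultrafilter ℕ, (U : Filter ℕ) ≤ atTop → ∀ v : H,
      (∀ y : H, Tendsto (fun n => ⟪z n, y⟫) U (𝓝 ⟪v, y⟫)) → E v = 0 := by
    intro U hU v hv
    have hEU := hEz.mono_left hU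
    have t1 : Tendsto (fun n => κ * ‖E (z n) - E v‖ ^ 2) U (𝓝 (κ * ‖(0 : H) - E v‖ ^ 2)) :=
      ((hEU.sub_const _).norm.pow 2).const_mul κ
    have t2 : Tendsto (fun n => ⟪z n - v, E (z n)⟫) U (𝓝 0) := by
      have hb : Tendsto (fun n => (M + ‖w‖ + ‖v‖) * ‖E (z n)‖) U (𝓝 0) := by
        simpa using (hL.mono_left hU).const_mul (M + ‖w‖ + ‖v‖)
      refine squeeze_zero_norm (fun n => ?_) hb
      refine (norm_inner_le_norm _ _).trans (mul_le_mul_of_nonneg_right ?_ (norm_nonneg _))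
      linarith [norm_sub_le (z n) v, hzb n]
    have t3 : Tendsto (fun n => ⟪z n - v, E v⟫) U (𝓝 0) := by
      have := (hv (E v)).sub_const ⟪v, E v⟫
      rw [sub_self] at this
      exact this.congr (fun n => (inner_sub_left _ _ _).symm)
    have t4 := t2.sub t3
    have t5 := le_of_tendsto_of_tendsto' t1 t4 (fun n => by
      rw [← inner_sub_right]; exact hE _ _)
    rw [zero_sub, norm_neg, sub_zero] at t5
    have : ‖E v‖ ^ 2 ≤ 0 := by nlinarith
    exact norm_eq_zero.1 (pow_eq_zero_iff (two_ne_zero) |>.1 (le_antisymm this (sq_nonneg _)))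
  -- Opial
  have hopial : ∀ v v' : H, E v = 0 → E v' = 0 → ∃ l, Tendsto (fun n => ⟪z n, v - v'⟫) atTop (𝓝 l) := by
    intro v v' h h'
    obtain ⟨l, hl⟩ := hconv v h
    obtain ⟨l', hl'⟩ := hconv v' h'
    have := (((hl'.pow 2).sub (hl.pow 2)).add_const (‖v‖ ^ 2 - ‖v'‖ ^ 2)).const_mul (1 / 2)
    refine ⟨_, this.congr (fun n => ?_)⟩
    rw [norm_sub_sq_real, norm_sub_sq_real, inner_sub_right]
    ring
  let U0 : Ultrafilter ℕ := Ultrafilter.of atTop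
  have hU0 : (U0 : Filter ℕ) ≤ atTop := Ultrafilter.of_le _
  obtain ⟨w0, hw0⟩ := aux_weak_ultra z _ hzb U0
  have hEw0 := hdemi U0 hU0 w0 hw0
  refine ⟨w0, hEw0, fun y => ?_⟩
  rw [tendsto_iff_ultrafilter]
  intro U hU
  obtain ⟨w1, hw1⟩ := aux_weak_ultra z _ hzb U
  have hEw1 := hdemi U hU w1 hw1
  obtain ⟨l, hl⟩ := hopial w0 w1 hEw0 hEw1
  have e0 := tendsto_nhds_unique (hw0 (w0 - w1)) (hl.mono_left hU0)
  have e1 := tendsto_nhds_unique (hw1 (w0 - w1)) (hl.mono_left hU)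
  have : ⟪w0 - w1, w0 - w1⟫ = 0 := by rw [inner_sub_left, e0, e1, sub_self]
  have : w0 = w1 := sub_eq_zero.1 (inner_self_eq_zero.1 this)
  rw [this]
  exact hw1 y

theorem statement8
    (V : Submodule ℝ H) (hV : IsClosed (V : Set H))
    (P : H → H) (hP : ∀ x : H, P x ∈ V ∧ x - P x ∈ Vᗮ)
    (A : H → Set H) (hA : IsMaxMonotoneOp A)
    (β : ℝ) (hβ : 0 < β)
    (B : H → H)
    (hB : ∀ x ∈ V, ∀ y ∈ V, β * ‖B x - B y‖ ^ 2 ≤ ⟪x - y, B x - B y⟫)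
    (Z : Set H) (hZ : Z = {x | ∃ u ∈ A x, ∃ w ∈ normalConeSub V x, u + B x + w = 0})
    (hZne : Z.Nonempty)
    (γ : ℝ) (hγ : γ ∈ Set.Ioo (0 : ℝ) (2 * β))
    (J : H → H) (hJ : ∀ x p : H, J x = p ↔ ∃ u ∈ A p, x - p = γ • u)
    (α : ℝ) (hα : α = max (2 / 3) (2 * γ / (γ + 2 * β)))
    (lam : ℕ → ℝ) (hlam : ∀ n, lam n ∈ Set.Ioo (0 : ℝ) (1 / α))
    (a b : ℕ → H)
    (hdiv : ¬ Summable (fun n => lam n * (1 - α * lam n)))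
    (herr : Summable (fun n => lam n * (‖a n‖ + ‖b n‖)))
    (z x y s p : ℕ → H)
    (hx : ∀ n, x n = P (z n))
    (hy : ∀ n, y n = γ⁻¹ • (x n - z n))
    (hs : ∀ n, s n = x n - γ • P (B (x n) + a n) + γ • y n)
    (hp : ∀ n, p n = J (s n) + b n)
    (hz : ∀ n, z (n + 1) = z n + lam n • (p n - x n)) :
    (∀ n, x n ∈ V ∧ y n ∈ Vᗮ) ∧
    ∃ xbar ∈ Z, ∃ ybar : H, ybar ∈ Vᗮ ∧ (∃ u ∈ A xbar, ybar = u + P (B xbar)) ∧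
      WeakLim x xbar ∧ WeakLim y ybar := by
  have : CompleteSpace V := hV.completeSpace_coe
  have hPQ : ∀ x, P x = V.starProjection x := fun x =>
    (Submodule.eq_starProjection_of_mem_orthogonal (hP x).1 (hP x).2).symm
  obtain ⟨hγ0, hγ1⟩ := hγ
  have hPsub : ∀ u v, P (u - v) = P u - P v := fun u v => by
    rw [hPQ, hPQ, hPQ, map_sub]
  have hPadd : ∀ u v, P (u + v) = P u + P v := fun u v => by
    rw [hPQ, hPQ, hPQ, map_add]
  have hPn : ∀ u, ‖P u‖ ≤ ‖u‖ := fun u => by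
    rw [hPQ]; exact Submodule.norm_starProjection_apply_le _ _
  have horth : ∀ u ∈ V, ∀ v ∈ Vᗮ, ⟪u, v⟫ = 0 := fun u hu v hv =>
    Submodule.inner_right_of_mem_orthogonal hu hv
  have hPi : ∀ u v, ⟪P u, v⟫ = ⟪u, P v⟫ := fun u v => by
    rw [hPQ, hPQ, Submodule.inner_starProjection_left_eq_right]
  have hγne : γ ≠ 0 := hγ0.ne'
  have hJf : ∀ u v, 0 ≤ ⟪J u - J v, (u - v) - (J u - J v)⟫ := by
    intro u v
    obtain ⟨u', hu', e1⟩ := (hJ u (J u)).1 rfl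
    obtain ⟨v', hv', e2⟩ := (hJ v (J v)).1 rfl
    have h := hA.1 _ _ _ _ hu' hv'
    have e3 : (u - v) - (J u - J v) = γ • (u' - v') := by
      rw [smul_sub, ← e1, ← e2]; abel
    rw [e3, real_inner_smul_right]
    exact mul_nonneg hγ0.le h
  have hJn : ∀ u v, ‖J u - J v‖ ≤ ‖u - v‖ := by
    intro u v
    have h := hJf u v
    rw [inner_sub_right, real_inner_self_eq_norm_sq] at h
    have h2 := real_inner_le_norm (J u - J v) (u - v)
    rcases (norm_nonneg (J u - J v)).eq_or_lt with h0 | h0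
    · rw [← h0]; exact norm_nonneg _
    · nlinarith
  -- cocoercivity of the projected operator
  have hC : ∀ u v, β * ‖P (B (P u)) - P (B (P v))‖ ^ 2 ≤
      ⟪P u - P v, P (B (P u)) - P (B (P v))⟫ := by
    intro u v
    have h := hB _ (hP u).1 _ (hP v).1
    have e1 : ⟪P u - P v, P (B (P u)) - P (B (P v))⟫ = ⟪P u - P v, B (P u) - B (P v)⟫ := by
      rw [← hPsub (B (P u)), ← hPi, hPQ (P u - P v),
        Submodule.starProjection_eq_self_iff.2 (V.sub_mem (hP u).1 (hP v).1)]
    rw [e1]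
    refine le_trans ?_ h
    rw [← hPsub]
    gcongr
    exact hPn _
  have hα0 : 0 < α := by
    rw [hα]; exact lt_max_of_lt_left (by norm_num)
  have hακ : 1 / (2 * α) ≤ 1 - γ / (4 * β) := by
    have h1 : 2 / 3 ≤ α := by rw [hα]; exact le_max_left _ _
    have h2 : 2 * γ / (γ + 2 * β) ≤ α := by rw [hα]; exact le_max_right _ _
    rw [div_le_iff₀ (by linarith)] at h2
    have e1 : 1 - γ / (4 * β) = (4 * β - γ) / (4 * β) := by field_simp
    rw [e1, div_le_div_iff₀ (by linarith) (by linarith)]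
    rcases le_total γ β with h | h
    · nlinarith
    · have h3 : 2 * γ * (4 * β - γ) ≤ α * (γ + 2 * β) * (4 * β - γ) :=
        mul_le_mul_of_nonneg_right h2 (by linarith)
      have h4 : 2 * β * (γ + 2 * β) ≤ 2 * γ * (4 * β - γ) := by nlinarith
      have h5 : (2 * β) * (γ + 2 * β) ≤ (α * (4 * β - γ)) * (γ + 2 * β) := by linarith
      have h6 := le_of_mul_le_mul_right h5 (by linarith)
      linarith
  set E : H → H := fun v => P v - J (P v + (P v - v) - γ • P (B (P v))) with hEdef
  have hE : ∀ u v, 1 / (2 * α) * ‖E u - E v‖ ^ 2 ≤ ⟪u - v, E u - E v⟫ := by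
    intro u v
    have hf := hJf (P u + (P u - u) - γ • P (B (P u))) (P v + (P v - v) - γ • P (B (P v)))
    have hc := hC u v
    have ho : ⟪P u - P v, (u - P u) - (v - P v)⟫ = 0 :=
      horth _ (V.sub_mem (hP u).1 (hP v).1) _ (Vᗮ.sub_mem (hP u).2 (hP v).2)
    set c := P (B (P u)) - P (B (P v)) with hcd
    set dv := P u - P v with hdv
    set dp := (u - P u) - (v - P v) with hdp
    set g := E u - E v with hg
    have e1 : J (P u + (P u - u) - γ • P (B (P u))) - J (P v + (P v - v) - γ • P (B (P v)))
        = dv - g := by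
      rw [hg, hdv, hEdef]; simp only; abel
    have e2 : P u + (P u - u) - γ • P (B (P u)) - (P v + (P v - v) - γ • P (B (P v)))
        = dv - dp - γ • c := by
      rw [hcd, hdv, hdp, smul_sub]; abel
    have e3 : u - v = dv + dp := by rw [hdv, hdp]; abel
    have e4 : dv - dp - γ • c - (dv - g) = g - dp - γ • c := by abel
    rw [e1, e2, e4] at hf
    rw [e3]
    simp only [inner_sub_left, inner_sub_right, real_inner_smul_right, ho,
      real_inner_self_eq_norm_sq] at hf
    rw [inner_add_left, real_inner_comm g dp]
    have hsq : 0 ≤ ‖g - (2 * β) • c‖ ^ 2 := sq_nonneg _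
    rw [norm_sub_sq_real, norm_smul, Real.norm_of_nonneg (by linarith : 0 ≤ 2 * β),
      real_inner_smul_right] at hsq
    have h1 := mul_le_mul_of_nonneg_right hακ (sq_nonneg ‖g‖)
    have h2 := mul_le_mul_of_nonneg_left hc hγ0.le
    have h3 := mul_nonneg (by positivity : 0 ≤ γ / (4 * β)) hsq
    have h4 : γ / (4 * β) * (‖g‖ ^ 2 - 2 * (2 * β * ⟪g, c⟫) + (2 * β * ‖c‖) ^ 2) =
        γ / (4 * β) * ‖g‖ ^ 2 - γ * ⟪g, c⟫ + γ * (β * ‖c‖ ^ 2) := by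
      field_simp
      ring
    rw [h4] at h3
    linarith
  have hzero : ∃ w, E w = 0 := by
    obtain ⟨x0, hx0⟩ := hZne
    rw [hZ] at hx0
    obtain ⟨u, hu, w', ⟨hxV, hwV⟩, heq⟩ := hx0
    have hmem : u + P (B x0) ∈ Vᗮ := by
      have e : u + P (B x0) = -w' - (B x0 - P (B x0)) := by
        rw [eq_neg_of_add_eq_zero_right heq]; abel
      rw [e]
      exact Vᗮ.sub_mem (Vᗮ.neg_mem hwV) (hP _).2
    refine ⟨x0 - γ • (u + P (B x0)), ?_⟩
    have hPw : P (x0 - γ • (u + P (B x0))) = x0 := by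
      rw [hPQ]
      refine Submodule.eq_starProjection_of_mem_orthogonal hxV ?_
      rw [sub_sub_cancel_left]
      exact Vᗮ.neg_mem (Vᗮ.smul_mem _ hmem)
    simp only [hEdef, hPw]
    rw [sub_eq_zero]
    symm
    rw [hJ]
    refine ⟨u, hu, ?_⟩
    rw [smul_add]; abel
  have hl1 : ∀ n, lam n < 2 * (1 / (2 * α)) := fun n => by
    have e : 2 * (1 / (2 * α)) = 1 / α := by field_simp
    rw [e]; exact (hlam n).2
  have hdiv' : ¬ Summable (fun n => lam n * (2 * (1 / (2 * α)) - lam n)) := by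
    intro h
    apply hdiv
    refine (h.mul_left α).congr (fun n => ?_)
    field_simp
  obtain ⟨w, hw, hwl⟩ := aux_km E (1 / (2 * α)) (by positivity) hE hzero lam (fun n => (hlam n).1)
    hl1 hdiv' (fun n => p n - x n + E (z n)) z (by
      refine Summable.of_nonneg_of_le (fun n => mul_nonneg (hlam n).1.le (norm_nonneg _)) ?_
        (herr.mul_left (γ + 1))
      intro n
      have h0 := (hlam n).1
      have e1 : p n - x n + E (z n) =
          (J (s n) - J (P (z n) + (P (z n) - z n) - γ • P (B (P (z n))))) + b n := by
        rw [hp n, hx n, hEdef]; simp only; abel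
      have e2 : s n - (P (z n) + (P (z n) - z n) - γ • P (B (P (z n)))) = -(γ • P (a n)) := by
        rw [hs n, hy n, hx n, smul_inv_smul₀ hγne, hPadd, smul_add]; abel
      have h1 := hJn (s n) (P (z n) + (P (z n) - z n) - γ • P (B (P (z n))))
      rw [e2, norm_neg, norm_smul, Real.norm_of_nonneg hγ0.le] at h1
      have h2 := mul_le_mul_of_nonneg_left (hPn (a n)) hγ0.le
      have h3 : ‖p n - x n + E (z n)‖ ≤ (γ + 1) * (‖a n‖ + ‖b n‖) := by
        rw [e1]
        refine (norm_add_le _ _).trans ?_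
        nlinarith [norm_nonneg (a n), mul_nonneg hγ0.le (norm_nonneg (b n))]
      calc _ ≤ lam n * ((γ + 1) * (‖a n‖ + ‖b n‖)) := mul_le_mul_of_nonneg_left h3 h0.le
        _ = _ := by ring) (by
      intro n
      rw [hz n]
      simp only [smul_add]
      abel)
  have hxl : WeakLim x (P w) := by
    intro v
    rw [hPi]
    refine (hwl (P v)).congr (fun n => ?_)
    rw [hx n, hPi]
  refine ⟨fun n => ⟨?_, ?_⟩, P w, ?_⟩
  · rw [hx n]; exact (hP _).1
  · rw [hy n, hx n, ← neg_sub]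
    exact Vᗮ.smul_mem _ (Vᗮ.neg_mem (hP _).2)
  have hyV : γ⁻¹ • (P w - w) ∈ Vᗮ := by
    rw [← neg_sub]
    exact Vᗮ.smul_mem _ (Vᗮ.neg_mem (hP _).2)
  obtain ⟨u, hu, hue⟩ := (hJ _ _).1 (sub_eq_zero.1 hw).symm
  have hyu : γ⁻¹ • (P w - w) = u + P (B (P w)) := by
    have e : P w - w = γ • (u + P (B (P w))) := by
      rw [smul_add, ← hue]; abel
    rw [e, inv_smul_smul₀ hγne]
  refine ⟨?_, γ⁻¹ • (P w - w), hyV, ⟨u, hu, hyu⟩, hxl, ?_⟩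
  · rw [hZ]
    refine ⟨u, hu, -(u + B (P w)), ⟨(hP w).1, ?_⟩, by abel⟩
    have e : u + B (P w) = γ⁻¹ • (P w - w) + (B (P w) - P (B (P w))) := by
      rw [hyu]; abel
    rw [e]
    exact Vᗮ.neg_mem (Vᗮ.add_mem hyV (hP _).2)
  · intro v
    have := ((hxl v).sub (hwl v)).const_mul γ⁻¹
    rw [← inner_sub_left, ← real_inner_smul_left] at this
    refine this.congr (fun n => ?_)
    rw [hy n, real_inner_smul_left, inner_sub_left]
end

section
/- Let H be a real Hilbert space, V a closed vector subspace of H, A : H → 2^H maximally monotone, B : H → H β-cocoercive on V for some β > 0, and assume the set Z of solutions of 0 ∈ Ax + Bx + N_V x is nonempty. Let γ > 0, let ε ∈ (0, max{1, β/γ}), let (δ_n) be a sequence in [ε, 2β/γ − ε], and let (λ_n) be a sequence in [ε, 1]. Let x_0 ∈ V, y_0 ∈ V⊥, and for each n ∈ ℕ suppose (p_n, q_n) ∈ H × H satisfies x_n − δ_n γ P_V(Bx_n) + γ y_n = p_n + γ q_n and P_V q_n/δ_n + P_{V⊥} q_n ∈ A( P_V p_n + P_{V⊥} p_n/δ_n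 ), and set x_{n+1} = x_n + λ_n(P_V p_n − x_n) and y_{n+1} = y_n + λ_n(P_{V⊥} q_n − y_n). Then x_n ∈ V and y_n ∈ V⊥ for all n, and there exist x̄ ∈ Z and ȳ ∈ V⊥ ∩ (Ax̄ + P_V(Bx̄)) such that: x_n converges weakly to x̄, y_n converges weakly to ȳ, x_{n+1} − x_n → 0 and y_{n+1} − y_n → 0 strongly, and P_V(Bx_n) converges strongly to P_V(Bx̄). -/
open Filter Topology
open scoped RealInnerProductSpace Pointwise

variable {H : Type*} [NormedAddCommGroup H] [InnerProductSpace ℝ H] [CompleteSpace H]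

theorem weak_cluster (z : ℕ → H) (R : ℝ) (hR : ∀ n, ‖z n‖ ≤ R) (U : Ultrafilter ℕ) :
    ∃ w : H, ∀ v : H, Tendsto (fun n => ⟪z n, v⟫) U (nhds ⟪w, v⟫) := by
  have key : ∀ v : H, ∃ c : ℝ, Tendsto (fun n => ⟪z n, v⟫) U (nhds c) ∧ |c| ≤ R * ‖v‖ := by
    intro v
    have hb : ∀ n, |⟪z n, v⟫| ≤ R * ‖v‖ := fun n =>
      (abs_real_inner_le_norm _ _).trans (mul_le_mul_of_nonneg_right (hR n) (norm_nonneg _))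
    have hc : IsCompact (Set.Icc (-(R * ‖v‖)) (R * ‖v‖)) := isCompact_Icc
    obtain ⟨c, hc1, hc2⟩ := hc.ultrafilter_le_nhds (U.map (fun n => ⟪z n, v⟫)) (by
      rw [Filter.le_principal_iff]
      refine Filter.mem_map.2 (Filter.univ_mem' fun n => ?_)
      exact abs_le.1 (hb n))
    exact ⟨c, hc2, abs_le.2 hc1⟩
  choose f hf hfb using key
  let L : H →ₗ[ℝ] ℝ :=
    { toFun := f
      map_add' := fun a b => by
        refine tendsto_nhds_unique (hf (a + b)) ?_
        simpa [inner_add_right] using (hf a).add (hf b)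
      map_smul' := fun c a => by
        refine tendsto_nhds_unique (hf (c • a)) ?_
        simpa [inner_smul_right] using (hf a).const_mul c }
  let L' : H →L[ℝ] ℝ := L.mkContinuous R (fun v => hfb v)
  refine ⟨(InnerProductSpace.toDual ℝ H).symm L', fun v => ?_⟩
  rw [InnerProductSpace.toDual_symm_apply]
  exact hf v

/-- Opial's lemma, via ultrafilters. -/
theorem opial (z : ℕ → H) (S : Set H) (hS : S.Nonempty)
    (hconv : ∀ s ∈ S, ∃ l : ℝ, Tendsto (fun n => ‖z n - s‖ ^ 2) atTop (nhds l))
    (hcl : ∀ U : Ultrafilter ℕ, (U : Filter ℕ) ≤ atTop → ∀ w : H,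
      (∀ v : H, Tendsto (fun n => ⟪z n, v⟫) U (nhds ⟪w, v⟫)) → w ∈ S) :
    ∃ w ∈ S, WeakLim z w := by
  obtain ⟨s, hs⟩ := hS
  obtain ⟨R, hR⟩ : ∃ R, ∀ n, ‖z n‖ ≤ R := by
    obtain ⟨l, hl⟩ := hconv s hs
    obtain ⟨K, hK⟩ := hl.bddAbove_range
    refine ⟨(K + 1) + ‖s‖, fun n => ?_⟩
    have h1 : ‖z n - s‖ ^ 2 ≤ K := hK ⟨n, rfl⟩
    have h2 : ‖z n‖ ≤ ‖z n - s‖ + ‖s‖ := by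
      simpa using norm_add_le (z n - s) s
    nlinarith [sq_nonneg (‖z n - s‖ - 1)]
  obtain ⟨w, hw⟩ := weak_cluster z R hR (Ultrafilter.of atTop)
  have hwS := hcl _ (Ultrafilter.of_le atTop) w hw
  refine ⟨w, hwS, fun v => ?_⟩
  rw [tendsto_iff_ultrafilter]
  intro U hU
  obtain ⟨w', hw'⟩ := weak_cluster z R hR U
  have hwS' := hcl _ hU w' hw'
  obtain ⟨l, hl⟩ := hconv w hwS
  obtain ⟨l', hl'⟩ := hconv w' hwS'
  have hd := hl.sub hl'
  have he : ∀ n, ⟪z n, w' - w⟫ = ((‖z n - w‖ ^ 2 - ‖z n - w'‖ ^ 2) - (‖w‖ ^ 2 - ‖w'‖ ^ 2)) / 2 := by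
    intro n
    rw [norm_sub_sq_real, norm_sub_sq_real, inner_sub_right]; ring
  have ht : Tendsto (fun n => ⟪z n, w' - w⟫) atTop
      (nhds (((l - l') - (‖w‖ ^ 2 - ‖w'‖ ^ 2)) / 2)) := by
    simp_rw [he]
    exact (hd.sub_const _).div_const _
  have e1 := tendsto_nhds_unique (hw (w' - w)) (ht.mono_left (Ultrafilter.of_le atTop))
  have e2 := tendsto_nhds_unique (hw' (w' - w)) (ht.mono_left hU)
  have e3 : ⟪w' - w, w' - w⟫ = 0 := by
    rw [inner_sub_left, e1, e2]; ring
  have e4 : w' = w := sub_eq_zero.1 (inner_self_eq_zero.1 e3)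
  rw [← e4]
  exact hw' v

/-- Product of weak and strong convergence. -/
theorem weak_strong (F : Filter ℕ) (a b : ℕ → H) (R : ℝ) (hR : ∀ n, ‖a n‖ ≤ R) (a' b' : H)
    (ha : ∀ v : H, Tendsto (fun n => ⟪a n, v⟫) F (nhds ⟪a', v⟫))
    (hb : Tendsto b F (nhds b')) :
    Tendsto (fun n => ⟪a n, b n⟫) F (nhds ⟪a', b'⟫) := by
  have h1 : Tendsto (fun n => ⟪a n, b n - b'⟫) F (nhds 0) := by
    have h2 : Tendsto (fun n => R * ‖b n - b'‖) F (nhds 0) := by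
      simpa using (tendsto_iff_norm_sub_tendsto_zero.1 hb).const_mul R
    refine squeeze_zero_norm (fun n => ?_) h2
    exact (abs_real_inner_le_norm _ _).trans
      (mul_le_mul_of_nonneg_right (hR n) (norm_nonneg _))
  have h3 := h1.add (ha b')
  simpa [inner_sub_right] using h3

theorem fb_step (z w s d : H) (δ κ : ℝ) (hδ : 0 < δ)
    (hC : κ * ‖d‖ ^ 2 ≤ ⟪z - s, d⟫)
    (hm : 0 ≤ ⟪w - s, δ⁻¹ • (z - w) - d⟫) :
    ‖w - s‖ ^ 2 ≤ ‖z - s‖ ^ 2 - ‖z - w - δ • d‖ ^ 2 - δ * (2 * κ - δ) * ‖d‖ ^ 2 := by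
  have h1 : 0 ≤ ⟪w - s, z - w⟫ - δ * ⟪w - s, d⟫ := by
    rw [inner_sub_right, inner_smul_right] at hm
    have := mul_nonneg hδ.le hm
    rw [mul_sub, mul_inv_cancel_left₀ hδ.ne'] at this
    exact this
  have e1 : ‖z - s‖ ^ 2 = ‖z - w‖ ^ 2 + 2 * ⟪w - s, z - w⟫ + ‖w - s‖ ^ 2 := by
    have : z - s = (z - w) + (w - s) := by abel
    rw [this, norm_add_sq_real, real_inner_comm]
  have e2 : ‖z - w - δ • d‖ ^ 2 = ‖z - w‖ ^ 2 - 2 * (δ * ⟪z - w, d⟫) + δ ^ 2 * ‖d‖ ^ 2 := by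
    rw [norm_sub_sq_real, inner_smul_right, norm_smul, mul_pow, Real.norm_eq_abs, sq_abs]
  have e3 : ⟪z - s, d⟫ = ⟪z - w, d⟫ + ⟪w - s, d⟫ := by
    rw [← inner_add_left]; congr 1; abel
  have h4 := mul_le_mul_of_nonneg_left hC hδ.le
  rw [e3] at h4
  nlinarith

theorem fb_thm (M : H → Set H) (hM : IsMaxMonotoneOp M) (C : H → H) (κ : ℝ) (hκ : 0 < κ)
    (hC : ∀ a b : H, κ * ‖C a - C b‖ ^ 2 ≤ ⟪a - b, C a - C b⟫)
    (hne : ∃ s, -C s ∈ M s) (ε : ℝ) (hε : 0 < ε)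
    (δ lam : ℕ → ℝ) (hδ : ∀ n, δ n ∈ Set.Icc ε (2 * κ - ε))
    (hlam : ∀ n, lam n ∈ Set.Icc ε 1) (z w : ℕ → H)
    (hm : ∀ n, (δ n)⁻¹ • (z n - w n) - C (z n) ∈ M (w n))
    (hz : ∀ n, z (n + 1) = z n + lam n • (w n - z n)) :
    ∃ s, -C s ∈ M s ∧ WeakLim z s ∧ Tendsto (fun n => z (n + 1) - z n) atTop (nhds 0) ∧
      Tendsto (fun n => C (z n)) atTop (nhds (C s)) := by
  have hδ0 : ∀ n, 0 < δ n := fun n => hε.trans_le (hδ n).1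
  have step : ∀ s, -C s ∈ M s → ∀ n, ε * (‖z n - w n - δ n • (C (z n) - C s)‖ ^ 2
      + ε ^ 2 * ‖C (z n) - C s‖ ^ 2) ≤ ‖z n - s‖ ^ 2 - ‖z (n + 1) - s‖ ^ 2 := by
    intro s hs n
    have h1 := fb_step (z n) (w n) s (C (z n) - C s) (δ n) κ (hδ0 n) (hC _ _) (by
      have := hM.1 _ _ _ _ (hm n) hs
      convert this using 2
      abel)
    have h2 : ‖z (n + 1) - s‖ ^ 2 ≤ (1 - lam n) * ‖z n - s‖ ^ 2 + lam n * ‖w n - s‖ ^ 2 := by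
      have e : z (n + 1) - s = (z n - s) + lam n • (w n - z n) := by rw [hz n]; abel
      have e' : w n - s = (z n - s) + (w n - z n) := by abel
      rw [e, e', norm_add_sq_real, norm_add_sq_real, inner_smul_right, norm_smul, mul_pow,
        Real.norm_eq_abs, sq_abs]
      have := (hlam n).1
      have := (hlam n).2
      have : 0 ≤ lam n * (1 - lam n) := mul_nonneg (by linarith) (by linarith)
      nlinarith [mul_nonneg this (sq_nonneg ‖w n - z n‖)]
    have h3 : ε ^ 2 ≤ δ n * (2 * κ - δ n) := by
      have h5 := (hδ n).1
      have h6 : ε ≤ 2 * κ - δ n := by linarith [(hδ n).2]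
      rw [sq]; exact mul_le_mul h5 h6 hε.le (hδ0 n).le
    have h4 := mul_le_mul_of_nonneg_right h3 (sq_nonneg ‖C (z n) - C s‖)
    set E := ‖z n - w n - δ n • (C (z n) - C s)‖ ^ 2 + ε ^ 2 * ‖C (z n) - C s‖ ^ 2 with hE
    have hE0 : 0 ≤ E := by positivity
    have h7 : ‖w n - s‖ ^ 2 ≤ ‖z n - s‖ ^ 2 - E := by linarith
    have h8 := mul_le_mul_of_nonneg_left h7 (hε.le.trans (hlam n).1)
    have h9 := mul_le_mul_of_nonneg_right (hlam n).1 hE0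
    nlinarith
  have hconv : ∀ s, -C s ∈ M s → ∃ l : ℝ, Tendsto (fun n => ‖z n - s‖ ^ 2) atTop (nhds l) := by
    intro s hs
    refine ⟨_, tendsto_atTop_ciInf (antitone_nat_of_succ_le fun n => ?_) ⟨0, ?_⟩⟩
    · have h := step s hs n
      have : 0 ≤ ε * (‖z n - w n - δ n • (C (z n) - C s)‖ ^ 2
        + ε ^ 2 * ‖C (z n) - C s‖ ^ 2) := by positivity
      linarith
    · rintro _ ⟨n, rfl⟩
      positivity
  obtain ⟨s, hs⟩ := hne
  obtain ⟨l, hl⟩ := hconv s hs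
  have hdiff : Tendsto (fun n => ‖z n - s‖ ^ 2 - ‖z (n + 1) - s‖ ^ 2) atTop (nhds 0) := by
    simpa using hl.sub ((tendsto_add_atTop_iff_nat 1).2 hl)
  have sq0 : ∀ (a : ℕ → H) (c : ℝ), 0 < c → (∀ n, c * ‖a n‖ ^ 2 ≤ ‖z n - s‖ ^ 2 - ‖z (n + 1) - s‖ ^ 2) →
      Tendsto a atTop (nhds 0) := by
    intro a c hc h
    have h1 : Tendsto (fun n => ‖a n‖ ^ 2) atTop (nhds 0) := by
      refine squeeze_zero (fun n => by positivity) (fun n => ?_)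
        (by simpa using hdiff.const_mul c⁻¹)
      rw [← div_eq_inv_mul, le_div_iff₀ hc, mul_comm]
      exact h n
    rw [tendsto_zero_iff_norm_tendsto_zero]
    have h2 := h1.sqrt
    simpa [Real.sqrt_sq] using h2
  have hd0 : Tendsto (fun n => C (z n) - C s) atTop (nhds 0) := by
    refine sq0 _ (ε * ε ^ 2) (by positivity) fun n => ?_
    have h := step s hs n
    have : 0 ≤ ε * ‖z n - w n - δ n • (C (z n) - C s)‖ ^ 2 := by positivity
    nlinarith
  have hr0 : Tendsto (fun n => z n - w n - δ n • (C (z n) - C s)) atTop (nhds 0) := by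
    refine sq0 _ ε hε fun n => ?_
    have h := step s hs n
    have : 0 ≤ ε * (ε ^ 2 * ‖C (z n) - C s‖ ^ 2) := by positivity
    nlinarith
  have hCz : Tendsto (fun n => C (z n)) atTop (nhds (C s)) := by
    simpa using hd0.add_const (C s)
  have bsm : ∀ (c : ℕ → ℝ) (K : ℝ) (a : ℕ → H), (∀ n, |c n| ≤ K) → Tendsto a atTop (nhds 0) →
      Tendsto (fun n => c n • a n) atTop (nhds 0) := by
    intro c K a hc ha
    refine squeeze_zero_norm (a := fun n => K * ‖a n‖) (fun n => ?_) (by simpa using ha.norm.const_mul K)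
    rw [norm_smul]
    exact mul_le_mul_of_nonneg_right (hc n) (norm_nonneg _)
  have hzw : Tendsto (fun n => z n - w n) atTop (nhds 0) := by
    have := hr0.add (bsm δ (2 * κ) _ (fun n => by
      rw [abs_of_pos (hδ0 n)]; linarith [(hδ n).2]) hd0)
    simpa using this
  have hdz : Tendsto (fun n => z (n + 1) - z n) atTop (nhds 0) := by
    have := bsm (fun n => - lam n) 1 _ (fun n => by
      rw [abs_neg, abs_of_pos (hε.trans_le (hlam n).1)]; exact (hlam n).2) hzw
    refine this.congr fun n => ?_
    rw [hz n, neg_smul, ← smul_neg, neg_sub]; abel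
  have hmn : Tendsto (fun n => (δ n)⁻¹ • (z n - w n) - C (z n)) atTop (nhds (-C s)) := by
    have := (bsm (fun n => (δ n)⁻¹) ε⁻¹ _ (fun n => by
      rw [abs_of_pos (inv_pos.2 (hδ0 n))]
      exact inv_anti₀ hε (hδ n).1) hzw).sub hCz
    simpa using this
  obtain ⟨R, hR⟩ : ∃ R, ∀ n, ‖z n‖ ≤ R := by
    obtain ⟨K, hK⟩ := hl.bddAbove_range
    refine ⟨(K + 1) + ‖s‖, fun n => ?_⟩
    have h1 : ‖z n - s‖ ^ 2 ≤ K := hK ⟨n, rfl⟩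
    have h2 : ‖z n‖ ≤ ‖z n - s‖ + ‖s‖ := by
      simpa using norm_add_le (z n - s) s
    nlinarith [sq_nonneg (‖z n - s‖ - 1)]
  have hcl : ∀ U : Ultrafilter ℕ, (U : Filter ℕ) ≤ atTop → ∀ t : H,
      (∀ v : H, Tendsto (fun n => ⟪z n, v⟫) U (nhds ⟪t, v⟫)) → -C t ∈ M t := by
    intro U hU t ht
    have shift : ∀ a v : H, Tendsto (fun n => ⟪z n - a, v⟫) U (nhds ⟪t - a, v⟫) := by
      intro a v
      simpa [inner_sub_left] using (ht v).sub_const ⟪a, v⟫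
    have hRa : ∀ a : H, ∀ n, ‖z n - a‖ ≤ R + ‖a‖ := fun a n =>
      (norm_sub_le _ _).trans (by linarith [hR n])
    have hCt : C s = C t := by
      have h1 : Tendsto (fun n => C (z n) - C t) U (nhds (C s - C t)) :=
        (hCz.mono_left hU).sub_const _
      have h2 := weak_strong U _ _ _ (hRa t) _ _ (shift t) h1
      have h3 := ((h1.norm.pow 2).const_mul κ)
      have h4 := le_of_tendsto_of_tendsto' h3 h2 (fun n => hC (z n) t)
      simp only [sub_self, inner_zero_left] at h4
      have h5 : ‖C s - C t‖ ^ 2 ≤ 0 := by nlinarith [sq_nonneg ‖C s - C t‖]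
      have h6 : ‖C s - C t‖ = 0 := by
        have := le_antisymm h5 (sq_nonneg _)
        exact pow_eq_zero_iff (two_ne_zero) |>.1 this
      exact sub_eq_zero.1 (norm_eq_zero.1 h6)
    rw [← hCt]
    refine hM.2 _ _ fun a b hab => ?_
    have h1 : Tendsto (fun n => (δ n)⁻¹ • (z n - w n) - C (z n) - b) U (nhds (-C s - b)) :=
      (hmn.mono_left hU).sub_const _
    have h2 := weak_strong U _ _ _ (hRa a) _ _ (shift a) h1
    have h3 := (hzw.mono_left hU).inner h1 (𝕜 := ℝ)
    have h4 := h2.sub h3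
    rw [inner_zero_left, sub_zero] at h4
    refine ge_of_tendsto' h4 fun n => ?_
    rw [← inner_sub_left]
    have e : z n - a - (z n - w n) = w n - a := by abel
    rw [e]
    exact hM.1 _ _ _ _ (hm n) hab
  obtain ⟨t, ht, htw⟩ := opial z {s | -C s ∈ M s} ⟨s, hs⟩ hconv hcl
  refine ⟨t, ht, htw, hdz, ?_⟩
  have hCt : C s = C t := by
    have h1 : Tendsto (fun n => C (z n) - C t) atTop (nhds (C s - C t)) := hCz.sub_const _
    have h2 := weak_strong atTop (fun n => z n - t) _ (R + ‖t‖) (fun n =>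
      (norm_sub_le _ _).trans (by linarith [hR n])) (t - t) _ (fun v => by
        simpa [inner_sub_left] using (htw v).sub_const ⟪t, v⟫) h1
    have h4 := le_of_tendsto_of_tendsto' ((h1.norm.pow 2).const_mul κ) h2 (fun n => hC (z n) t)
    simp only [sub_self, inner_zero_left] at h4
    have h5 : ‖C s - C t‖ ^ 2 ≤ 0 := by nlinarith [sq_nonneg ‖C s - C t‖]
    have h6 : ‖C s - C t‖ = 0 := by
      have := le_antisymm h5 (sq_nonneg _)
      exact pow_eq_zero_iff (two_ne_zero) |>.1 this
    exact sub_eq_zero.1 (norm_eq_zero.1 h6)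
  rw [← hCt]
  exact hCz

theorem statement13
    (V : Submodule ℝ H) (hV : IsClosed (V : Set H))
    (P : H → H) (hP : ∀ x : H, P x ∈ V ∧ x - P x ∈ Vᗮ)
    (A : H → Set H) (hA : IsMaxMonotoneOp A)
    (β : ℝ) (hβ : 0 < β)
    (B : H → H)
    (hB : ∀ x ∈ V, ∀ y ∈ V, β * ‖B x - B y‖ ^ 2 ≤ ⟪x - y, B x - B y⟫)
    (Z : Set H) (hZ : Z = {x | ∃ u ∈ A x, ∃ w ∈ normalConeSub V x, u + B x + w = 0})
    (hZne : Z.Nonempty)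
    (γ : ℝ) (hγ : 0 < γ)
    (ε : ℝ) (hε : ε ∈ Set.Ioo (0 : ℝ) (max 1 (β / γ)))
    (δ : ℕ → ℝ) (hδ : ∀ n, δ n ∈ Set.Icc ε (2 * β / γ - ε))
    (lam : ℕ → ℝ) (hlam : ∀ n, lam n ∈ Set.Icc ε 1)
    (x y p q : ℕ → H)
    (hx0 : x 0 ∈ V) (hy0 : y 0 ∈ Vᗮ)
    (hpq : ∀ n, x n - (δ n * γ) • P (B (x n)) + γ • y n = p n + γ • q n)
    (hinc : ∀ n, (δ n)⁻¹ • P (q n) + (q n - P (q n)) ∈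
      A (P (p n) + (δ n)⁻¹ • (p n - P (p n))))
    (hxr : ∀ n, x (n + 1) = x n + lam n • (P (p n) - x n))
    (hyr : ∀ n, y (n + 1) = y n + lam n • ((q n - P (q n)) - y n)) :
    (∀ n, x n ∈ V ∧ y n ∈ Vᗮ) ∧
    ∃ xbar ∈ Z, ∃ ybar : H, ybar ∈ Vᗮ ∧ (∃ u ∈ A xbar, ybar = u + P (B xbar)) ∧
      WeakLim x xbar ∧ WeakLim y ybar ∧
      Tendsto (fun n => x (n + 1) - x n) atTop (nhds 0) ∧
      Tendsto (fun n => y (n + 1) - y n) atTop (nhds 0) ∧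
      Tendsto (fun n => P (B (x n))) atTop (nhds (P (B xbar))) := by
  have hcomp : CompleteSpace V := hV.completeSpace_coe
  obtain ⟨Q, hQ⟩ : ∃ Q : H →L[ℝ] H, ∀ x, P x = Q x :=
    ⟨V.starProjection, fun x =>
      (Submodule.eq_starProjection_of_mem_orthogonal (hP x).1 (hP x).2).symm⟩
  simp only [hQ] at *
  clear hQ P
  have hQV : ∀ a ∈ V, Q a = a := by
    intro a ha
    have h1 : a - Q a ∈ V := V.sub_mem ha (hP a).1
    have h2 : ⟪a - Q a, a - Q a⟫ = 0 := V.inner_right_of_mem_orthogonal h1 (hP a).2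
    exact (sub_eq_zero.1 (inner_self_eq_zero.1 h2)).symm
  have hQO : ∀ a ∈ Vᗮ, Q a = 0 := by
    intro a ha
    have h1 : Q a ∈ Vᗮ := by
      have := Vᗮ.sub_mem ha (hP a).2
      simpa using this
    have h2 : ⟪Q a, Q a⟫ = 0 := V.inner_right_of_mem_orthogonal (hP a).1 h1
    exact inner_self_eq_zero.1 h2
  have hQQ : ∀ a, Q (Q a) = Q a := fun a => hQV _ (hP a).1
  have ho : ∀ a b, ⟪Q a, b⟫ = ⟪Q a, Q b⟫ := by
    intro a b
    have : ⟪Q a, b - Q b⟫ = 0 := V.inner_right_of_mem_orthogonal (hP a).1 (hP b).2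
    rw [inner_sub_right] at this; linarith
  have ho' : ∀ a b, ⟪a, Q b⟫ = ⟪Q a, Q b⟫ := by
    intro a b
    rw [real_inner_comm, ho, real_inner_comm]
  have hswap : ∀ a b : H, ⟪Q a + (b - Q b), Q b + (a - Q a)⟫ = ⟪a, b⟫ := by
    intro a b
    simp only [inner_add_left, inner_add_right, inner_sub_left, inner_sub_right]
    rw [ho a a, ho' b b, ho b a, ho' b a, real_inner_comm a b,
      real_inner_comm (Q a) (Q b)]
    ring
  have hxy : ∀ n, x n ∈ V ∧ y n ∈ Vᗮ := by
    intro n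
    induction n with
    | zero => exact ⟨hx0, hy0⟩
    | succ k ih =>
      rw [hxr, hyr]
      exact ⟨V.add_mem ih.1 (V.smul_mem _ (V.sub_mem (hP _).1 ih.1)),
        Vᗮ.add_mem ih.2 (Vᗮ.smul_mem _ (Vᗮ.sub_mem (hP _).2 ih.2))⟩
  refine ⟨hxy, ?_⟩
  set M : H → Set H := fun w => {m | γ⁻¹ • (Q m + (w - Q w)) ∈ A (Q w + (m - Q m))} with hMdef
  set C : H → H := fun z => γ • Q (B (Q z)) with hCdef
  have hγ' : γ ≠ 0 := hγ.ne'
  have hM : IsMaxMonotoneOp M := by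
    constructor
    · intro a b u v hu hv
      have h := hA.1 _ _ _ _ hu hv
      rw [← smul_sub, inner_smul_right] at h
      have h2 := nonneg_of_mul_nonneg_right h (inv_pos.2 hγ)
      rw [← hswap]
      have e1 : Q (a - b) + (u - v - Q (u - v)) = Q a + (u - Q u) - (Q b + (v - Q v)) := by
        simp only [map_sub]; abel
      have e2 : Q (u - v) + (a - b - Q (a - b)) = Q u + (a - Q a) - (Q v + (b - Q b)) := by
        simp only [map_sub]; abel
      rw [e1, e2]
      exact h2
    · intro a u h
      refine hA.2 _ _ fun b v hbv => ?_
      have hQv : Q (v - Q v) = 0 := hQO _ (hP v).2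
      have hQb : Q (b - Q b) = 0 := hQO _ (hP b).2
      have h1 := h (Q b + γ • (v - Q v)) (γ • Q v + (b - Q b)) (by
        show _ ∈ A _
        simp only [map_add, map_smul, hQQ, hQv, hQb, smul_zero, add_zero]
        have e1 : γ⁻¹ • (γ • Q v + (Q b + γ • (v - Q v) - Q b)) = v := by
          rw [add_sub_cancel_left, ← smul_add, smul_smul, inv_mul_cancel₀ hγ', one_smul]; abel
        have e2 : Q b + (γ • Q v + (b - Q b) - γ • Q v) = b := by abel
        rw [e1, e2]
        exact hbv)
      rw [← hswap] at h1
      simp only [map_sub, map_add, map_smul, hQQ, sub_self, smul_zero, add_zero] at h1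
      have h2 := mul_nonneg (inv_pos.2 hγ).le h1
      rw [← inner_smul_right] at h2
      have e1 : Q a - Q b + (u - (γ • Q v + (b - Q b)) - (Q u - γ • Q v))
          = Q a + (u - Q u) - b := by abel
      have e2 : γ⁻¹ • (Q u - γ • Q v + (a - (Q b + γ • (v - Q v)) - (Q a - Q b)))
          = γ⁻¹ • (Q u + (a - Q a)) - v := by
        have e3 : Q u - γ • Q v + (a - (Q b + γ • (v - Q v)) - (Q a - Q b))
          = Q u + (a - Q a) - γ • v := by rw [smul_sub]; abel
        rw [e3, smul_sub, smul_smul, inv_mul_cancel₀ hγ', one_smul]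
      rw [e1, e2] at h2
      exact h2
  have hQn : ∀ a, ‖Q a‖ ^ 2 ≤ ‖a‖ ^ 2 := by
    intro a
    have e : ‖a‖ ^ 2 = ‖Q a‖ ^ 2 + ‖a - Q a‖ ^ 2 := by
      have h0 : ⟪Q a, a - Q a⟫ = 0 := V.inner_right_of_mem_orthogonal (hP a).1 (hP a).2
      have : a = Q a + (a - Q a) := by abel
      conv_lhs => rw [this]
      rw [norm_add_sq_real, h0]; ring
    nlinarith [sq_nonneg ‖a - Q a‖]
  have hC : ∀ a b : H, (β / γ) * ‖C a - C b‖ ^ 2 ≤ ⟪a - b, C a - C b⟫ := by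
    intro a b
    have h1 := hB _ (hP a).1 _ (hP b).1
    have h2 := hQn (B (Q a) - B (Q b))
    have e : C a - C b = γ • Q (B (Q a) - B (Q b)) := by simp [hCdef, smul_sub]
    rw [e, inner_smul_right, norm_smul, mul_pow, Real.norm_eq_abs, sq_abs, ho', ← ho, map_sub Q a b]
    have e2 : β / γ * (γ ^ 2 * ‖Q (B (Q a) - B (Q b))‖ ^ 2)
        = γ * (β * ‖Q (B (Q a) - B (Q b))‖ ^ 2) := by field_simp
    rw [e2]
    refine mul_le_mul_of_nonneg_left ?_ hγ.le
    exact (mul_le_mul_of_nonneg_left h2 hβ.le).trans h1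
  have hne : ∃ s, -C s ∈ M s := by
    obtain ⟨a, ha⟩ := hZne
    rw [hZ] at ha
    obtain ⟨u, hu, v, ⟨haV, hv⟩, huv⟩ := ha
    have hy : u + Q (B a) ∈ Vᗮ := by
      have e : u + Q (B a) = -(v + (B a - Q (B a))) := by
        rw [eq_neg_iff_add_eq_zero, ← huv]; abel
      rw [e]
      exact Vᗮ.neg_mem (Vᗮ.add_mem hv (hP _).2)
    refine ⟨a + γ • (u + Q (B a)), ?_⟩
    show _ ∈ A _
    have e1 : Q (a + γ • (u + Q (B a))) = a := by
      rw [map_add, map_smul, hQO _ hy, hQV _ haV]; simp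
    simp only [hCdef, e1, map_neg, map_smul, hQQ]
    have e2 : γ⁻¹ • (-(γ • Q (B a)) + (a + γ • (u + Q (B a)) - a)) = u := by
      rw [add_sub_cancel_left, ← smul_neg, ← smul_add, smul_smul, inv_mul_cancel₀ hγ', one_smul]
      abel
    rw [e2, sub_self, add_zero]
    exact hu
  have hQx : ∀ n, Q (x n) = x n := fun n => hQV _ (hxy n).1
  have hQy : ∀ n, Q (y n) = 0 := fun n => hQO _ (hxy n).2
  obtain ⟨s, hs, hsw, hdz, hCz⟩ := fb_thm M hM C (β / γ) (div_pos hβ hγ) hC hne ε hε.1 δ lam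
    (fun n => by rw [← mul_div_assoc]; exact hδ n) hlam (fun n => x n + γ • y n)
    (fun n => Q (p n) + γ • (q n - Q (q n))) (fun n => by
      have hδ0 : δ n ≠ 0 := (hε.1.trans_le (hδ n).1).ne'
      have hQq : Q (q n - Q (q n)) = 0 := hQO _ (hP _).2
      have hQp : Q (p n - Q (p n)) = 0 := hQO _ (hP _).2
      have hCx : C (x n + γ • y n) = γ • Q (B (x n)) := by
        simp [hCdef, hQx, hQy]
      have e : (δ n)⁻¹ • (x n + γ • y n - (Q (p n) + γ • (q n - Q (q n)))) - C (x n + γ • y n)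
          = (δ n)⁻¹ • (γ • Q (q n) + (p n - Q (p n))) := by
        rw [hCx]
        have h1 : γ • Q (B (x n)) = (δ n)⁻¹ • ((δ n * γ) • Q (B (x n))) := by
          rw [smul_smul, ← mul_assoc, inv_mul_cancel₀ hδ0, one_mul]
        rw [h1, ← smul_sub]
        congr 1
        have h2 : x n + γ • y n = p n + γ • q n + (δ n * γ) • Q (B (x n)) := by
          rw [← hpq n]; abel
        rw [h2, smul_sub]; abel
      rw [e]
      show _ ∈ A _
      simp only [map_add, map_smul, hQQ, hQq, hQp, smul_zero, add_zero]
      convert hinc n using 1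
      · simp only [smul_add]; abel_nf
      · simp only [smul_add, smul_smul, add_sub_cancel_left]
        congr 2
        · field_simp
        · simp [hγ']) (fun n => by
      simp only [hxr n, hyr n, smul_add, smul_sub, smul_smul, mul_comm γ (lam n)]
      abel)
  have wx : WeakLim x (Q s) := by
    intro v
    have := hsw (Q v)
    rw [ho', ← ho] at this
    refine this.congr fun n => ?_
    rw [ho', ← ho]; simp [hQx, hQy]
  have ey : ∀ n, y n = γ⁻¹ • ((x n + γ • y n) - x n) := fun n => by simp [hγ']
  have hu : γ⁻¹ • (s - Q s) - Q (B (Q s)) ∈ A (Q s) := by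
    have h : _ ∈ A _ := hs
    simp only [hCdef, map_neg, map_smul, hQQ] at h
    rw [smul_add, smul_neg, smul_smul, inv_mul_cancel₀ hγ', one_smul, sub_self, add_zero] at h
    rwa [sub_eq_neg_add]
  have hyb : γ⁻¹ • (s - Q s) ∈ Vᗮ := Vᗮ.smul_mem _ (hP s).2
  have dx : Tendsto (fun n => x (n + 1) - x n) atTop (nhds 0) := by
    have := (Q.continuous.tendsto 0).comp hdz
    rw [map_zero] at this
    refine this.congr fun n => ?_
    simp [hQx, hQy]
  refine ⟨Q s, ?_, γ⁻¹ • (s - Q s), hyb, ⟨_, hu, by abel⟩, wx, ?_, dx, ?_, ?_⟩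
  · rw [hZ]
    refine ⟨_, hu, -(γ⁻¹ • (s - Q s)) - (B (Q s) - Q (B (Q s))), ⟨(hP s).1, ?_⟩, by abel⟩
    exact Vᗮ.sub_mem (Vᗮ.neg_mem hyb) (hP _).2
  · intro v
    have := ((hsw v).sub (wx v)).const_mul γ⁻¹
    rw [← inner_sub_left, ← real_inner_smul_left] at this
    refine this.congr fun n => ?_
    rw [← inner_sub_left, ← real_inner_smul_left, ← ey]
  · have := (hdz.sub dx).const_smul γ⁻¹
    rw [sub_zero, smul_zero] at this
    refine this.congr fun n => ?_
    conv_rhs => rw [ey (n + 1), ey n]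
    rw [← smul_sub]; congr 1; abel
  · have := hCz.const_smul γ⁻¹
    simpa [hCdef, hQx, hQy, hγ'] using this
end

section
/- Let H be a real Hilbert space, V a closed vector subspace of H, f : H → (−∞, +∞] a proper lower semicontinuous convex function, g : H → ℝ a differentiable convex function whose gradient ∇g is (1/β)-Lipschitz for some β > 0, and assume zer(∂f + ∇g + N_V) ≠ ∅. Let γ ∈ (0, 2β), set α = max{2/3, 2γ/(γ+2β)}, let (λ_n) be a sequence in (0, 1/α), let (a_n) and (b_n) be sequences in H with Σ_n λ_n(1−αλ_n) = +∞ and Σ_n λ_n(‖a_n‖+‖b_n‖) < +∞. Let z_0 ∈ H and for every n ∈ ℕ set x_n = P_V z_n, y_n = (x_n − z_n)/γ, s_n = x_n − γP_V(∇g(x_n) + a_n) + γy_n, p_n = prox_{γf}(s_n) + b_n, and z_{n+1} = z_n + λ_n(p_n − x_n). Then x_n ∈ V and y_n ∈ V⊥ for all n, and there exist x̄ minimizing f + g over V with 0 ∈ ∂f(x̄) + ∇g(x̄) + N_V(x̄) and ȳ ∈ V⊥ ∩ (∂f(x̄) + P_V(∇g(x̄))) such that: x_n converges weakly to x̄, y_n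 converges weakly to ȳ, x_{n+1} − x_n → 0 and y_{n+1} − y_n → 0 strongly, and Σ_{n∈ℕ} λ_n ‖P_V(∇g(x_n) − ∇g(x̄))‖² < +∞. -/
open Filter Topology
open scoped RealInnerProductSpace Pointwise

variable {H : Type*} [NormedAddCommGroup H] [InnerProductSpace ℝ H] [CompleteSpace H]

/-- The convex subdifferential of an extended-real-valued function:
`∂f(x) = {u | ∀ y, ⟪y - x, u⟫ + f x ≤ f y}`. -/
def subdiffE (f : H → EReal) : H → Set H :=
  fun x => {u | ∀ y : H, ((⟪y - x, u⟫ : ℝ) : EReal) + f x ≤ f y}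

set_option linter.unusedSectionVars false

theorem fdr_line {g : H → ℝ} {g' : H → H} (hg : ∀ x, HasGradientAt g (g' x) x) (v u : H) (s : ℝ) :
    HasDerivAt (fun s : ℝ => g (v + s • (u - v))) ⟪g' (v + s • (u - v)), u - v⟫ s := by
  have h1 := (hg (v + s • (u - v))).hasFDerivAt
  have h2 : HasDerivAt (fun s : ℝ => v + s • (u - v)) (u - v) s := by
    simpa using ((hasDerivAt_id s).smul_const (u - v)).const_add v
  have h3 := h1.comp_hasDerivAt s h2
  simpa [Function.comp_def] using h3

theorem fdr_first_order {g : H → ℝ} {g' : H → H} (hg : ∀ x, HasGradientAt g (g' x) x)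
    (hgconv : ConvexOn ℝ Set.univ g) (u v : H) : g v + ⟪g' v, u - v⟫ ≤ g u := by
  have hd := fdr_line hg v u 0
  have hc : ConvexOn ℝ Set.univ (fun s : ℝ => g (v + s • (u - v))) := by
    refine ⟨convex_univ, fun a _ b _ p q hp hq hpq => ?_⟩
    have := hgconv.2 (Set.mem_univ (v + a • (u - v))) (Set.mem_univ (v + b • (u - v))) hp hq hpq
    have e : v + (p • a + q • b) • (u - v) = p • (v + a • (u - v)) + q • (v + b • (u - v)) := by
      have : v = (p + q) • v := by rw [hpq, one_smul]
      simp only [smul_eq_mul]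
      rw [show v + (p * a + q * b) • (u - v) = (p + q) • v + (p * a + q * b) • (u - v) by rw [← this]]
      module
    simp only [e]
    exact this
  have := hc.le_slope_of_hasDerivAt (Set.mem_univ 0) (Set.mem_univ 1) one_pos hd
  simp [slope_def_field] at this
  linarith

theorem fdr_descent {g : H → ℝ} {g' : H → H} (hg : ∀ x, HasGradientAt g (g' x) x)
    (L : ℝ) (hLip : ∀ x y : H, ‖g' x - g' y‖ ≤ L * ‖x - y‖) (u v : H) :
    g u ≤ g v + ⟪g' v, u - v⟫ + L / 2 * ‖u - v‖ ^ 2 := by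
  let φ : ℝ → ℝ := fun s => g (v + s • (u - v)) - s * ⟪g' v, u - v⟫ - L / 2 * ‖u - v‖ ^ 2 * s ^ 2
  have hφ : ∀ s, HasDerivAt φ (⟪g' (v + s • (u - v)), u - v⟫ - ⟪g' v, u - v⟫
      - L * ‖u - v‖ ^ 2 * s) s := by
    intro s
    have h1 := ((fdr_line hg v u s).sub ((hasDerivAt_id s).mul_const ⟪g' v, u - v⟫)).sub
      (((hasDerivAt_id s).pow 2).const_mul (L / 2 * ‖u - v‖ ^ 2))
    refine h1.congr_deriv ?_
    simp
    ring
  have hanti : AntitoneOn φ (Set.Icc 0 1) := by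
    refine antitoneOn_of_deriv_nonpos (convex_Icc 0 1)
      (fun s _ => (hφ s).continuousAt.continuousWithinAt)
      (fun s _ => (hφ s).differentiableAt.differentiableWithinAt) ?_
    intro s hs
    rw [interior_Icc] at hs
    rw [(hφ s).deriv, ← inner_sub_left]
    have h1 := real_inner_le_norm (g' (v + s • (u - v)) - g' v) (u - v)
    have h2 := hLip (v + s • (u - v)) v
    rw [add_sub_cancel_left, norm_smul, Real.norm_of_nonneg hs.1.le] at h2
    have h3 := mul_le_mul_of_nonneg_right h2 (norm_nonneg (u - v))
    nlinarith
  have := hanti (Set.left_mem_Icc.2 zero_le_one) (Set.right_mem_Icc.2 zero_le_one) zero_le_one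
  simp [φ] at this
  linarith

theorem fdr_bh {g : H → ℝ} {g' : H → H} (hg : ∀ x, HasGradientAt g (g' x) x)
    (hgconv : ConvexOn ℝ Set.univ g) (β : ℝ) (hβ : 0 < β)
    (hLip : ∀ x y : H, ‖g' x - g' y‖ ≤ (1 / β) * ‖x - y‖) (u v : H) :
    g v + ⟪g' v, u - v⟫ + β / 2 * ‖g' u - g' v‖ ^ 2 ≤ g u := by
  have h1 := fdr_first_order hg hgconv (u - β • (g' u - g' v)) v
  have h2 := fdr_descent hg (1 / β) hLip (u - β • (g' u - g' v)) u
  have e1 : u - β • (g' u - g' v) - v = (u - v) - β • (g' u - g' v) := by abel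
  have e2 : u - β • (g' u - g' v) - u = - (β • (g' u - g' v)) := by abel
  rw [e1, inner_sub_right, inner_smul_right] at h1
  rw [e2, inner_neg_right, inner_smul_right, norm_neg, norm_smul, Real.norm_of_nonneg hβ.le] at h2
  have h3 : ⟪g' u, g' u - g' v⟫ - ⟪g' v, g' u - g' v⟫ = ‖g' u - g' v‖ ^ 2 := by
    rw [← inner_sub_left, real_inner_self_eq_norm_sq]
  have h4 : 1 / β / 2 * (β * ‖g' u - g' v‖) ^ 2 = β / 2 * ‖g' u - g' v‖ ^ 2 := by
    field_simp
  rw [h4] at h2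
  have h5 : β * ⟪g' u, g' u - g' v⟫ - β * ⟪g' v, g' u - g' v⟫ = β * ‖g' u - g' v‖ ^ 2 := by
    rw [← h3]; ring
  linarith

theorem fdr_seqA {u δ : ℕ → ℝ} (hu : ∀ n, 0 ≤ u n) (hδ : ∀ n, 0 ≤ δ n) (hs : Summable δ)
    (h : ∀ n, u (n + 1) ≤ u n + δ n) : ∃ l, Tendsto u atTop (𝓝 l) := by
  have hanti : Antitone (fun n => u n - ∑ i ∈ Finset.range n, δ i) := by
    refine antitone_nat_of_succ_le fun n => ?_
    rw [Finset.sum_range_succ]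
    linarith [h n]
  have hb : BddBelow (Set.range (fun n => u n - ∑ i ∈ Finset.range n, δ i)) := by
    refine ⟨-∑' i, δ i, ?_⟩
    rintro _ ⟨n, rfl⟩
    have := hs.sum_le_tsum (Finset.range n) (fun i _ => hδ i)
    simp only
    linarith [hu n]
  have h1 := (tendsto_atTop_ciInf hanti hb).add hs.hasSum.tendsto_sum_nat
  exact ⟨_, by simpa using h1⟩

theorem fdr_seqB {u c δ : ℕ → ℝ} (hu : ∀ n, 0 ≤ u n) (hδ : ∀ n, 0 ≤ δ n) (hs : Summable δ)
    (hc : ∀ n, 0 ≤ c n) (h : ∀ n, u (n + 1) + c n ≤ u n + δ n) : Summable c := by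
  refine summable_of_sum_range_le (c := u 0 + ∑' i, δ i) hc fun n => ?_
  have h1 : ∑ i ∈ Finset.range n, c i + u n ≤ u 0 + ∑ i ∈ Finset.range n, δ i := by
    induction n with
    | zero => simp
    | succ k ih => rw [Finset.sum_range_succ, Finset.sum_range_succ]; linarith [h k]
  have := hs.sum_le_tsum (Finset.range n) (fun i _ => hδ i)
  linarith [hu n]

theorem fdr_weak_cpt (U : Ultrafilter ℕ) (z : ℕ → H) (M : ℝ) (hz : ∀ n, ‖z n‖ ≤ M) :
    ∃ w : H, ∀ y : H, Tendsto (fun n => ⟪z n, y⟫) U (𝓝 ⟪w, y⟫) := by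
  have hK := WeakDual.isCompact_closedBall (𝕜 := ℝ) (E := H) 0 M
  let F : ℕ → WeakDual ℝ H := fun n => StrongDual.toWeakDual (InnerProductSpace.toDual ℝ H (z n))
  have hm : (U.map F : Filter (WeakDual ℝ H)) ≤ 𝓟 (WeakDual.toStrongDual ⁻¹' Metric.closedBall 0 M) := by
    rw [le_principal_iff]
    refine Filter.mem_map.2 (Filter.univ_mem' fun n => ?_)
    simp only [Set.mem_preimage, mem_closedBall_zero_iff]
    show ‖InnerProductSpace.toDual ℝ H (z n)‖ ≤ M
    rw [LinearIsometryEquiv.norm_map]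
    exact hz n
  obtain ⟨ψ, _, hψ⟩ := hK.ultrafilter_le_nhds (U.map F) hm
  refine ⟨(InnerProductSpace.toDual ℝ H).symm (WeakDual.toStrongDual ψ), fun y => ?_⟩
  rw [InnerProductSpace.toDual_symm_apply]
  have h1 : Tendsto F U (𝓝 ψ) := hψ
  have h2 := ((WeakDual.eval_continuous (𝕜 := ℝ) y).tendsto ψ).comp h1
  exact h2

theorem fdr_opial (z : ℕ → H) (F : Set H)
    (hconv : ∀ q ∈ F, ∃ l, Tendsto (fun n => ‖z n - q‖) atTop (𝓝 l)) (hne : F.Nonempty)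
    (hdemi : ∀ U : Ultrafilter ℕ, (U : Filter ℕ) ≤ atTop → ∀ w : H,
      (∀ y : H, Tendsto (fun n => ⟪z n, y⟫) U (𝓝 ⟪w, y⟫)) → w ∈ F) :
    ∃ w ∈ F, WeakLim z w := by
  obtain ⟨q, hq⟩ := hne
  obtain ⟨l, hl⟩ := hconv q hq
  obtain ⟨M, hM⟩ := hl.bddAbove_range
  have hb : ∀ n, ‖z n‖ ≤ M + ‖q‖ := by
    intro n
    have h1 : ‖z n - q‖ ≤ M := hM ⟨n, rfl⟩
    have h2 := norm_add_le (z n - q) q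
    rw [sub_add_cancel] at h2
    linarith
  have key : ∀ U : Ultrafilter ℕ, (U : Filter ℕ) ≤ atTop → ∃ w ∈ F,
      ∀ y : H, Tendsto (fun n => ⟪z n, y⟫) U (𝓝 ⟪w, y⟫) := by
    intro U hU
    obtain ⟨w, hw⟩ := fdr_weak_cpt U z _ hb
    exact ⟨w, hdemi U hU w hw, hw⟩
  have uniq : ∀ U U' : Ultrafilter ℕ, (U : Filter ℕ) ≤ atTop → (U' : Filter ℕ) ≤ atTop →
      ∀ w ∈ F, ∀ w' ∈ F, (∀ y : H, Tendsto (fun n => ⟪z n, y⟫) U (𝓝 ⟪w, y⟫)) →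
      (∀ y : H, Tendsto (fun n => ⟪z n, y⟫) U' (𝓝 ⟪w', y⟫)) → w = w' := by
    intro U U' hU hU' w hwF w' hwF' hw hw'
    obtain ⟨l1, h1⟩ := hconv w hwF
    obtain ⟨l2, h2⟩ := hconv w' hwF'
    have h3 := (h1.pow 2).sub (h2.pow 2)
    have e : ∀ n, ‖z n - w‖ ^ 2 - ‖z n - w'‖ ^ 2 = 2 * ⟪z n, w' - w⟫ + (‖w‖ ^ 2 - ‖w'‖ ^ 2) := by
      intro n
      rw [norm_sub_sq_real, norm_sub_sq_real, inner_sub_right]; ring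
    simp only [e] at h3
    have a1 := tendsto_nhds_unique (h3.mono_left hU) (((hw (w' - w)).const_mul 2).add_const _)
    have a2 := tendsto_nhds_unique (h3.mono_left hU') (((hw' (w' - w)).const_mul 2).add_const _)
    have a3 : ⟪w' - w, w' - w⟫ = 0 := by
      rw [inner_sub_left]; linarith
    exact (sub_eq_zero.1 (inner_self_eq_zero.1 a3)).symm
  obtain ⟨w, hwF, hw⟩ := key (Ultrafilter.of atTop) (Ultrafilter.of_le atTop)
  refine ⟨w, hwF, fun y => ?_⟩
  rw [tendsto_iff_ultrafilter]
  intro U hU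
  obtain ⟨w', hwF', hw'⟩ := key U hU
  have := uniq _ _ hU (Ultrafilter.of_le atTop) w' hwF' w hwF hw' hw
  rw [← this]
  exact hw' y


theorem fdr_pair (z d e : H) (t lam : ℝ) (hl : 0 ≤ lam)
    (hF : 0 ≤ ⟪-d - e, z + d⟫) (hC : 1 / (2 * t) * ‖e‖ ^ 2 ≤ ⟪z, e⟫) :
    ‖z + lam • d‖ ^ 2 ≤ ‖z‖ ^ 2
      - lam * (1 / t * ‖e‖ ^ 2 + 2 * ⟪d, e⟫ + (2 - lam) * ‖d‖ ^ 2) := by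
  rw [norm_add_sq_real, inner_smul_right, norm_smul, Real.norm_of_nonneg hl]
  have h1 : ⟪-d - e, z + d⟫ = - ⟪z, d⟫ - ‖d‖ ^ 2 - ⟪z, e⟫ - ⟪d, e⟫ := by
    simp only [inner_sub_left, inner_neg_left, inner_add_right, real_inner_self_eq_norm_sq]
    rw [real_inner_comm z d, real_inner_comm z e, real_inner_comm d e]
    ring
  rw [h1] at hF
  have h2 : 1 / t * ‖e‖ ^ 2 = 2 * (1 / (2 * t) * ‖e‖ ^ 2) := by
    rw [one_div, one_div, mul_inv]; ring
  rw [h2]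
  nlinarith [mul_nonneg hl hF, mul_nonneg hl (sub_nonneg.2 hC)]

theorem fdr_young (x y : H) (c M s : ℝ) (hc : |c| ≤ M) (hs : 0 < s) :
    c * ⟪x, y⟫ ≤ M * (s * ‖x‖ ^ 2 + 1 / (4 * s) * ‖y‖ ^ 2) := by
  have h1 : c * ⟪x, y⟫ ≤ M * (‖x‖ * ‖y‖) := by
    calc c * ⟪x, y⟫ ≤ |c * ⟪x, y⟫| := le_abs_self _
      _ = |c| * |⟪x, y⟫| := abs_mul _ _
      _ ≤ M * (‖x‖ * ‖y‖) := mul_le_mul hc (abs_real_inner_le_norm x y) (abs_nonneg _)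
        ((abs_nonneg _).trans hc)
  have h2 : ‖x‖ * ‖y‖ ≤ s * ‖x‖ ^ 2 + 1 / (4 * s) * ‖y‖ ^ 2 := by
    have : s * ‖x‖ ^ 2 + 1 / (4 * s) * ‖y‖ ^ 2 - ‖x‖ * ‖y‖ = (2 * s * ‖x‖ - ‖y‖) ^ 2 / (4 * s) := by
      field_simp; ring
    have h3 : 0 ≤ (2 * s * ‖x‖ - ‖y‖) ^ 2 / (4 * s) := by positivity
    linarith
  exact h1.trans (mul_le_mul_of_nonneg_left h2 ((abs_nonneg _).trans hc))

/-- relation between `t` and `α`. -/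
theorem fdr_alpha (t α : ℝ) (ht0 : 0 < t) (ht1 : t < 1) (hα : α = max (2 / 3) (2 * t / (1 + t))) :
    2 / 3 ≤ α ∧ α < 1 ∧ 1 / α ≤ 2 - t ∧ (t ≠ 1 / 2 → 1 / α < 2 - t) := by
  have h1 : 2 / 3 ≤ α := hα ▸ le_max_left _ _
  have h2 : 2 * t / (1 + t) ≤ α := hα ▸ le_max_right _ _
  have h3 : α < 1 := by
    rw [hα, max_lt_iff]
    refine ⟨by norm_num, ?_⟩
    rw [div_lt_one (by linarith)]; linarith
  have hα0 : 0 < α := by linarith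
  rw [div_le_iff₀ (by linarith)] at h2
  refine ⟨h1, h3, ?_, fun hne => ?_⟩
  · rw [div_le_iff₀ hα0]
    rcases le_total t (1 / 2) with h | h
    · nlinarith
    · have h5 : 0 ≤ (2 * t - 1) * (1 - t) := mul_nonneg (by linarith) (by linarith)
      have : (1 + t) ≤ (2 - t) * (α * (1 + t)) := by nlinarith
      have : 0 ≤ (1 + t) * ((2 - t) * α - 1) := by nlinarith
      have := nonneg_of_mul_nonneg_right this (by linarith)
      linarith
  · rw [div_lt_iff₀ hα0]
    rcases lt_or_gt_of_ne hne with h | h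
    · nlinarith
    · have h5 : 0 < (2 * t - 1) * (1 - t) := mul_pos (by linarith) (by linarith)
      have : (1 + t) < (2 - t) * (α * (1 + t)) := by nlinarith
      have : 0 < (1 + t) * ((2 - t) * α - 1) := by nlinarith
      have := (mul_pos_iff_of_pos_left (show 0 < 1 + t by linarith)).1 this
      linarith

theorem fdr_quad (d e : H) (t σ : ℝ) (hσ : 0 < σ) :
    (1 / t - 1 / σ) * ‖e‖ ^ 2 ≤ 1 / t * ‖e‖ ^ 2 + 2 * ⟪d, e⟫ + σ * ‖d‖ ^ 2 := by
  have h := fdr_young d e (-1) 1 (σ / 2) (by simp) (by linarith)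
  have e1 : 1 / (4 * (σ / 2)) = 1 / σ / 2 := by field_simp; norm_num
  rw [e1] at h
  linarith

theorem fdr_quad2 (d e : H) (t : ℝ) (ht : 0 < t) :
    0 ≤ 1 / t * ‖e‖ ^ 2 + 2 * ⟪d, e⟫ + t * ‖d‖ ^ 2 := by
  have := fdr_quad d e t t ht
  simpa using this

theorem fdr_ne (z d e : H) (t lam μ : ℝ) (ht : 0 < t) (hl : 0 ≤ lam) (hμ : μ ≤ 2 - t)
    (hF : 0 ≤ ⟪-d - e, z + d⟫) (hC : 1 / (2 * t) * ‖e‖ ^ 2 ≤ ⟪z, e⟫) :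
    ‖z + lam • d‖ ^ 2 ≤ ‖z‖ ^ 2 - lam * (μ - lam) * ‖d‖ ^ 2 := by
  have h1 := fdr_pair z d e t lam hl hF hC
  have h2 := fdr_quad2 d e t ht
  have h3 : (μ - lam) * ‖d‖ ^ 2 ≤ 1 / t * ‖e‖ ^ 2 + 2 * ⟪d, e⟫ + (2 - lam) * ‖d‖ ^ 2 := by
    nlinarith [mul_nonneg (sub_nonneg.2 hμ) (sq_nonneg ‖d‖)]
  nlinarith [mul_le_mul_of_nonneg_left h3 hl]

/-- critical case: `t = 1/2`, `lam` close to `3/2`. -/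
theorem fdr_crit (e d E D : H) (lam coc : ℝ) (h1 : 149 / 100 ≤ lam) (h2 : lam ≤ 3 / 2)
    (hcoc : 0 ≤ coc)
    (hF : 0 ≤ ⟪-(D - d) - (E - e), lam • d + (D - d)⟫)
    (hC : ‖E - e‖ ^ 2 ≤ ⟪lam • d, E - e⟫)
    (hG : ⟪E, -e - lam • d⟫ + 1 / 2 * ‖E‖ ^ 2 ≤ coc) :
    ‖e‖ ^ 2 ≤ 100 * (‖d‖ ^ 2 - ‖D‖ ^ 2) + 1000000 * (coc + ‖e + (1 / 2 : ℝ) • d‖ ^ 2) := by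
  obtain ⟨η, rfl⟩ : ∃ η : H, d = (-2 : ℝ) • e + (2 : ℝ) • η :=
    ⟨e + (1 / 2 : ℝ) • d, by module⟩
  have e0 : e + (1 / 2 : ℝ) • ((-2 : ℝ) • e + (2 : ℝ) • η) = η := by module
  rw [e0]
  have a1 : -(D - ((-2 : ℝ) • e + (2 : ℝ) • η)) - (E - e) =
    (-1 : ℝ) • D - (1 : ℝ) • e + (2 : ℝ) • η - (1 : ℝ) • E := by module
  have a2 : lam • ((-2 : ℝ) • e + (2 : ℝ) • η) + (D - ((-2 : ℝ) • e + (2 : ℝ) • η)) =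
    (-2 * (lam - 1)) • e + (2 * (lam - 1)) • η + (1 : ℝ) • D := by module
  have a3 : -e - lam • ((-2 : ℝ) • e + (2 : ℝ) • η) = (2 * lam - 1) • e - (2 * lam) • η := by module
  rw [a1, a2] at hF
  rw [a3] at hG
  rw [norm_sub_sq_real] at hC
  have hd : ‖(-2 : ℝ) • e + (2 : ℝ) • η‖ ^ 2 = 4 * ‖e‖ ^ 2 - 8 * ⟪e, η⟫ + 4 * ‖η‖ ^ 2 := by
    rw [norm_add_sq_real]
    simp only [norm_smul, inner_smul_left, inner_smul_right]
    norm_num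
    ring
  rw [hd]
  simp only [inner_sub_left, inner_add_left, inner_sub_right, inner_add_right, inner_smul_left,
    inner_smul_right, real_inner_self_eq_norm_sq, conj_trivial] at hF hC hG
  simp only [real_inner_comm e D, real_inner_comm e E, real_inner_comm e η, real_inner_comm η D,
    real_inner_comm η E, real_inner_comm D E] at *
  have y1 := fdr_young D E (-1) 1 (37 / 100) (by simp) (by norm_num)
  have y2 := fdr_young e D (2 * lam - 3) (2 / 100) (1 / 2) (by rw [abs_le]; constructor <;> linarith)
    (by norm_num)
  have y3 := fdr_young η D (4 - 2 * lam) (102 / 100) 100 (by rw [abs_le]; constructor <;> linarith)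
    (by norm_num)
  have y4 := fdr_young e η (-6 * (lam - 1) - 14 / 10 * lam) (51 / 10) (1 / 1000)
    (by rw [abs_le]; constructor <;> linarith) (by norm_num)
  have y5 := fdr_young η E (2 - 6 / 10 * lam) (12 / 10) 100
    (by rw [abs_le]; constructor <;> linarith) (by norm_num)
  have y6 := fdr_young η E (2 * lam) 3 (3 / 2)
    (by rw [abs_le]; constructor <;> linarith) (by norm_num)
  have y7 := fdr_young e η 8 8 (1 / 2000) (by norm_num) (by norm_num)
  have b0 : 0 ≤ coc + 9 / 2 * ‖η‖ ^ 2 := by positivity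
  have b1 : (2 * lam - 1) * ⟪e, E⟫ ≤ coc + 9 / 2 * ‖η‖ ^ 2 := by
    norm_num at y6
    linarith
  have b2 : ⟪e, E⟫ ≤ coc + 9 / 2 * ‖η‖ ^ 2 := by
    rcases le_total ⟪e, E⟫ 0 with h | h
    · linarith
    · nlinarith
  have b3 : 6 / 10 * (lam - 1) * ⟪e, E⟫ ≤ 3 / 10 * (coc + 9 / 2 * ‖η‖ ^ 2) := by
    have := mul_le_mul_of_nonneg_left b2 (show 0 ≤ 6 / 10 * (lam - 1) by linarith)
    nlinarith
  have b4 : (34 / 10 * lam - 27 / 10) * ‖e‖ ^ 2 ≤ 24 / 10 * ‖e‖ ^ 2 :=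
    mul_le_mul_of_nonneg_right (by linarith) (sq_nonneg _)
  have b5 : 4 * (lam - 1) * ‖η‖ ^ 2 ≤ 2 * ‖η‖ ^ 2 :=
    mul_le_mul_of_nonneg_right (by linarith) (sq_nonneg _)
  have q1 := sq_nonneg ‖e‖
  have q2 := sq_nonneg ‖η‖
  have q3 := sq_nonneg ‖E‖
  have q4 := sq_nonneg ‖D‖
  norm_num at y1 y2 y3 y4 y5 y7
  linarith

theorem fdr_coco {C : H → H} {G : H → ℝ} {t : ℝ}
    (hG1 : ∀ u v, G v + ⟪C v, u - v⟫ + 1 / (4 * t) * ‖C u - C v‖ ^ 2 ≤ G u) (u v : H) :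
    1 / (2 * t) * ‖C u - C v‖ ^ 2 ≤ ⟪u - v, C u - C v⟫ := by
  have h1 := hG1 u v
  have h2 := hG1 v u
  rw [norm_sub_rev (C v) (C u), ← neg_sub u v, inner_neg_right] at h2
  have h3 : 1 / (2 * t) * ‖C u - C v‖ ^ 2 = 2 * (1 / (4 * t) * ‖C u - C v‖ ^ 2) := by
    rw [one_div, one_div, mul_inv, mul_inv]; ring
  rw [h3, inner_sub_right, real_inner_comm, real_inner_comm (C v)]
  linarith

theorem fdr_mono {C d : H → H} {G : H → ℝ} {t μ : ℝ} (ht : 0 < t) (hμ0 : 0 < μ) (hμ : μ ≤ 2 - t)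
    (hF : ∀ u v, 0 ≤ ⟪-(d u - d v) - (C u - C v), (u - v) + (d u - d v)⟫)
    (hG1 : ∀ u v, G v + ⟪C v, u - v⟫ + 1 / (4 * t) * ‖C u - C v‖ ^ 2 ≤ G u)
    (z : H) (lam : ℝ) (h0 : 0 < lam) (h1 : lam < μ) : ‖d (z + lam • d z)‖ ≤ ‖d z‖ := by
  have a1 := fdr_ne (z + lam • d z - z) (d (z + lam • d z) - d z) (C (z + lam • d z) - C z) t μ μ ht
    hμ0.le hμ (hF _ _) (fdr_coco hG1 _ _)
  simp only [sub_self, mul_zero, zero_mul, sub_zero, add_sub_cancel_left] at a1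
  have a2 := abs_le_of_sq_le_sq a1 (norm_nonneg _)
  rw [abs_of_nonneg (norm_nonneg _), norm_smul, Real.norm_of_nonneg h0.le] at a2
  have e1 : μ • d (z + lam • d z) = (lam • d z + μ • (d (z + lam • d z) - d z)) + (μ - lam) • d z := by
    module
  have a3 := norm_add_le (lam • d z + μ • (d (z + lam • d z) - d z)) ((μ - lam) • d z)
  rw [← e1, norm_smul, norm_smul, Real.norm_of_nonneg hμ0.le, Real.norm_of_nonneg (sub_pos.2 h1).le]
    at a3
  have a4 : μ * ‖d (z + lam • d z)‖ ≤ μ * ‖d z‖ := by linarith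
  exact le_of_mul_le_mul_left a4 hμ0

theorem fdr_step {C d : H → H} {G : H → ℝ} {t α : ℝ} (ht : 0 < t) (ht1 : t < 1)
    (hα : α = max (2 / 3) (2 * t / (1 + t)))
    (hF : ∀ u v, 0 ≤ ⟪-(d u - d v) - (C u - C v), (u - v) + (d u - d v)⟫)
    (hG1 : ∀ u v, G v + ⟪C v, u - v⟫ + 1 / (4 * t) * ‖C u - C v‖ ^ 2 ≤ G u)
    (hG2 : ∀ u v, G u ≤ G v + ⟪C v, u - v⟫ + t * ‖u - v‖ ^ 2) :
    ∃ K : ℝ, 0 ≤ K ∧ ∀ (z zs : H) (lam : ℝ), d zs = 0 → 0 < lam → lam < 1 / α →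
      lam * ‖C z - C zs‖ ^ 2 ≤ K * ((‖z - zs‖ ^ 2 - ‖z + lam • d z - zs‖ ^ 2) +
        (‖d z‖ ^ 2 - ‖d (z + lam • d z)‖ ^ 2)) := by
  obtain ⟨hα1, hα2, hα3, hα4⟩ := fdr_alpha t α ht ht1 hα
  have hμ0 : 0 < 1 / α := by positivity
  have hdd : ∀ (z : H) (lam : ℝ), 0 < lam → lam < 1 / α →
      0 ≤ ‖d z‖ ^ 2 - ‖d (z + lam • d z)‖ ^ 2 := by
    intro z lam h0 h1
    have := fdr_mono ht hμ0 hα3 hF hG1 z lam h0 h1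
    have := pow_le_pow_left₀ (norm_nonneg _) this 2
    linarith
  have hpair : ∀ (z zs : H) (lam : ℝ), d zs = 0 → 0 < lam →
      lam * (1 / t * ‖C z - C zs‖ ^ 2 + 2 * ⟪d z, C z - C zs⟫ + (2 - lam) * ‖d z‖ ^ 2) ≤
      ‖z - zs‖ ^ 2 - ‖z + lam • d z - zs‖ ^ 2 := by
    intro z zs lam hzs h0
    have h := hF z zs
    rw [hzs, sub_zero] at h
    have := fdr_pair (z - zs) (d z) (C z - C zs) t lam h0.le h (fdr_coco hG1 z zs)
    rw [show z + lam • d z - zs = z - zs + lam • d z by abel]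
    linarith
  -- non-critical relaxation
  have hnc : ∀ (z zs : H) (lam σ : ℝ), d zs = 0 → 0 < lam → 0 < σ → lam ≤ 2 - σ →
      lam * ((1 / t - 1 / σ) * ‖C z - C zs‖ ^ 2) ≤ ‖z - zs‖ ^ 2 - ‖z + lam • d z - zs‖ ^ 2 := by
    intro z zs lam σ hzs h0 hσ hl
    refine le_trans (mul_le_mul_of_nonneg_left ?_ h0.le) (hpair z zs lam hzs h0)
    refine (fdr_quad (d z) (C z - C zs) t σ hσ).trans ?_
    have : σ * ‖d z‖ ^ 2 ≤ (2 - lam) * ‖d z‖ ^ 2 :=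
      mul_le_mul_of_nonneg_right (by linarith) (sq_nonneg _)
    linarith
  by_cases hcrit : t = 1 / 2
  · have hαv : α = 2 / 3 := by
      rw [hα, hcrit]; norm_num
    have hαi : 1 / α = 3 / 2 := by rw [hαv]; norm_num
    rw [hαi] at hdd ⊢
    refine ⟨10000000, by norm_num, fun z zs lam hzs h0 h1 => ?_⟩
    have hD := hdd z lam h0 h1
    rcases lt_or_ge lam (149 / 100) with hl | hl
    · have := hnc z zs lam (51 / 100) hzs h0 (by norm_num) (by linarith)
      rw [hcrit] at this
      norm_num at this
      have h3 : 0 ≤ lam * ‖C z - C zs‖ ^ 2 := by positivity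
      nlinarith
    · set e := C z - C zs with he
      set zt := z + lam • d z with hzt
      set E := C zt - C zs with hE
      have hcc := fdr_coco hG1 z zs
      rw [← he, hcrit] at hcc
      norm_num at hcc
      have f1 : 0 ≤ ⟪-(d zt - d z) - (E - e), lam • d z + (d zt - d z)⟫ := by
        have := hF zt z
        rw [show C zt - C z = E - e by rw [hE, he]; abel,
          show zt - z = lam • d z by rw [hzt]; abel] at this
        exact this
      have f2 : ‖E - e‖ ^ 2 ≤ ⟪lam • d z, E - e⟫ := by
        have := fdr_coco hG1 zt z
        rw [show C zt - C z = E - e by rw [hE, he]; abel,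
          show zt - z = lam • d z by rw [hzt]; abel, hcrit] at this
        norm_num at this
        exact this
      have f3 : ⟪E, -e - lam • d z⟫ + 1 / 2 * ‖E‖ ^ 2 ≤ ⟪z - zs, e⟫ - ‖e‖ ^ 2 := by
        have A := hG1 zs z
        have B := hG2 (z - e) z
        have Cc := hG1 (z - e) zt
        have Dd := hG1 zt zs
        rw [hcrit] at A B Cc Dd
        have p0 := sq_nonneg ‖C (z - e) - C zt‖
        rw [norm_sub_rev (C zs) (C z), ← he, show zs - z = -(z - zs) by abel, inner_neg_right] at A
        rw [show z - e - z = -e by abel, inner_neg_right, norm_neg] at B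
        rw [show z - e - zt = -e - lam • d z by rw [hzt]; abel] at Cc
        rw [← hE, show zt - zs = (z - zs) - e - (-e - lam • d z) by rw [hzt]; abel] at Dd
        rw [inner_sub_right, inner_sub_right] at Dd
        have q1 : ⟪E, -e - lam • d z⟫ = ⟪C zt, -e - lam • d z⟫ - ⟪C zs, -e - lam • d z⟫ := by
          rw [hE, inner_sub_left]
        have q2 : ⟪z - zs, e⟫ = ⟪C z, z - zs⟫ - ⟪C zs, z - zs⟫ := by
          rw [real_inner_comm]; rw [← inner_sub_left]
        have q3 : ‖e‖ ^ 2 = ⟪C z, e⟫ - ⟪C zs, e⟫ := by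
          rw [← inner_sub_left, ← real_inner_self_eq_norm_sq]
        rw [q1, q2]
        norm_num at A B Cc Dd
        linarith
      have f4 := fdr_crit e (d z) E (d zt) lam (⟪z - zs, e⟫ - ‖e‖ ^ 2) hl h1.le (by linarith)
        f1 f2 f3
      have f5 : lam * (2 * (⟪z - zs, e⟫ - ‖e‖ ^ 2) + 2 * ‖e + (1 / 2 : ℝ) • d z‖ ^ 2) ≤
          ‖z - zs‖ ^ 2 - ‖zt - zs‖ ^ 2 := by
        have h := hF z zs
        rw [hzs, sub_zero, ← he] at h
        rw [show zt - zs = z - zs + lam • d z by rw [hzt]; abel, norm_add_sq_real (z - zs),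
          inner_smul_right, norm_smul, Real.norm_of_nonneg h0.le]
        have h1' : ⟪-d z - e, z - zs + d z⟫ =
            - ⟪z - zs, d z⟫ - ‖d z‖ ^ 2 - ⟪z - zs, e⟫ - ⟪d z, e⟫ := by
          rw [inner_sub_left, inner_neg_left, inner_add_right, inner_add_right,
            real_inner_self_eq_norm_sq, real_inner_comm (z - zs), real_inner_comm (z - zs) e,
            real_inner_comm (d z) e]
          ring
        rw [h1'] at h
        rw [norm_add_sq_real, inner_smul_right, norm_smul, real_inner_comm (d z) e]
        norm_num
        nlinarith [mul_nonneg h0.le h, mul_nonneg (mul_nonneg h0.le (sub_nonneg.2 h1.le)) (sq_nonneg ‖d z‖)]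
      have f6 : 0 ≤ 2 * (⟪z - zs, e⟫ - ‖e‖ ^ 2) + 2 * ‖e + (1 / 2 : ℝ) • d z‖ ^ 2 := by
        have := sq_nonneg ‖e + (1 / 2 : ℝ) • d z‖
        linarith
      have f7 := sq_nonneg ‖e‖
      nlinarith
  · have hlt := hα4 hcrit
    have hσ : 0 < 2 - 1 / α := by linarith
    have hpos : 0 < 1 / t - 1 / (2 - 1 / α) := by
      have := one_div_lt_one_div_of_lt ht (show t < 2 - 1 / α by linarith)
      linarith
    refine ⟨(1 / t - 1 / (2 - 1 / α))⁻¹, by positivity, fun z zs lam hzs h0 h1 => ?_⟩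
    have h2 := hnc z zs lam (2 - 1 / α) hzs h0 hσ (by linarith)
    have hD := hdd z lam h0 h1
    rw [inv_mul_eq_div, le_div_iff₀ hpos]
    linarith

theorem fdr_main {C d : H → H} {G : H → ℝ} {t α : ℝ} (ht : 0 < t) (ht1 : t < 1)
    (hα : α = max (2 / 3) (2 * t / (1 + t)))
    (hF : ∀ u v, 0 ≤ ⟪-(d u - d v) - (C u - C v), (u - v) + (d u - d v)⟫)
    (hG1 : ∀ u v, G v + ⟪C v, u - v⟫ + 1 / (4 * t) * ‖C u - C v‖ ^ 2 ≤ G u)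
    (hG2 : ∀ u v, G u ≤ G v + ⟪C v, u - v⟫ + t * ‖u - v‖ ^ 2)
    (hfix : ∃ zs, d zs = 0)
    (lam : ℕ → ℝ) (hlam : ∀ n, lam n ∈ Set.Ioo (0 : ℝ) (1 / α))
    (hdiv : ¬ Summable (fun n => lam n * (1 - α * lam n)))
    (ε z : ℕ → H) (herr : Summable (fun n => lam n * ‖ε n‖))
    (hz : ∀ n, z (n + 1) = z n + lam n • (d (z n) + ε n)) :
    ∃ zb, d zb = 0 ∧ WeakLim z zb ∧ Tendsto (fun n => z (n + 1) - z n) atTop (𝓝 0) ∧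
      Summable (fun n => lam n * ‖C (z n) - C zb‖ ^ 2) := by
  obtain ⟨hα1, hα2, hα3, hα4⟩ := fdr_alpha t α ht ht1 hα
  have hα0 : 0 < α := by linarith
  have hμ0 : 0 < 1 / α := by positivity
  obtain ⟨K, hK0, hK⟩ := fdr_step ht ht1 hα hF hG1 hG2
  have hne : ∀ (u v : H) (l : ℝ), 0 ≤ l →
      ‖(u - v) + l • (d u - d v)‖ ^ 2 ≤ ‖u - v‖ ^ 2 - l * (1 / α - l) * ‖d u - d v‖ ^ 2 :=
    fun u v l hl => fdr_ne _ _ (C u - C v) t l (1 / α) ht hl hα3 (hF u v) (fdr_coco hG1 u v)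
  -- T nonexpansive
  have hT : ∀ u v : H, ‖(u + d u) - (v + d v)‖ ≤ ‖u - v‖ := by
    intro u v
    have h := hne u v 1 zero_le_one
    have h1 : 1 ≤ 1 / α := by rw [le_div_iff₀ hα0]; linarith
    rw [one_smul, show u - v + (d u - d v) = (u + d u) - (v + d v) by abel] at h
    have h2 : 0 ≤ 1 * (1 / α - 1) * ‖d u - d v‖ ^ 2 :=
      mul_nonneg (by linarith) (sq_nonneg _)
    exact le_of_sq_le_sq (by linarith) (norm_nonneg _)
  set δ : ℕ → ℝ := fun n => lam n * ‖ε n‖ with hδ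
  have hδ0 : ∀ n, 0 ≤ δ n := fun n => mul_nonneg (hlam n).1.le (norm_nonneg _)
  set w : ℕ → H := fun n => z n + lam n • d (z n) with hw
  have hzw : ∀ n, z (n + 1) = w n + lam n • ε n := by
    intro n; rw [hz n, smul_add]; simp only [hw]; abel
  have hnε : ∀ n, ‖lam n • ε n‖ = δ n := by
    intro n; rw [norm_smul, Real.norm_of_nonneg (hlam n).1.le]
  have hfe : ∀ zs, d zs = 0 → ∀ n, ‖w n - zs‖ ^ 2 ≤
      ‖z n - zs‖ ^ 2 - lam n * (1 / α - lam n) * ‖d (z n)‖ ^ 2 := by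
    intro zs hzs n
    have h := hne (z n) zs (lam n) (hlam n).1.le
    rw [hzs, sub_zero] at h
    rw [show w n - zs = z n - zs + lam n • d (z n) by simp only [hw]; abel]
    exact h
  have hll : ∀ n, 0 ≤ lam n * (1 / α - lam n) := fun n =>
    mul_nonneg (hlam n).1.le (sub_nonneg.2 (hlam n).2.le)
  have hfe1 : ∀ zs, d zs = 0 → ∀ n, ‖w n - zs‖ ≤ ‖z n - zs‖ := by
    intro zs hzs n
    have h := hfe zs hzs n
    have h2 := mul_nonneg (hll n) (sq_nonneg ‖d (z n)‖)
    exact le_of_sq_le_sq (by linarith) (norm_nonneg _)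
  have hfe2 : ∀ zs n, ‖z (n + 1) - zs‖ ≤ ‖w n - zs‖ + δ n := by
    intro zs n
    rw [hzw n, show w n + lam n • ε n - zs = (w n - zs) + lam n • ε n by abel, ← hnε n]
    exact norm_add_le _ _
  have hconv : ∀ zs, d zs = 0 → ∃ l, Tendsto (fun n => ‖z n - zs‖) atTop (𝓝 l) := by
    intro zs hzs
    exact fdr_seqA (fun n => norm_nonneg _) hδ0 herr
      (fun n => (hfe2 zs n).trans (add_le_add_left (hfe1 zs hzs n) _))
  have hd1 : ∀ n, ‖d (w n)‖ ≤ ‖d (z n)‖ := fun n =>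
    fdr_mono ht hμ0 hα3 hF hG1 (z n) (lam n) (hlam n).1 (hlam n).2
  have hd2 : ∀ n, ‖d (z (n + 1))‖ ≤ ‖d (w n)‖ + 2 * δ n := by
    intro n
    have h1 := hT (z (n + 1)) (w n)
    have h2 : z (n + 1) - w n = lam n • ε n := by rw [hzw n]; abel
    have h3 : d (z (n + 1)) = d (w n) + ((z (n + 1) + d (z (n + 1))) - (w n + d (w n)))
        - (z (n + 1) - w n) := by abel
    calc ‖d (z (n + 1))‖ = _ := congrArg _ h3
      _ ≤ ‖d (w n) + ((z (n + 1) + d (z (n + 1))) - (w n + d (w n)))‖ + ‖z (n + 1) - w n‖ :=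
        norm_sub_le _ _
      _ ≤ ‖d (w n)‖ + ‖(z (n + 1) + d (z (n + 1))) - (w n + d (w n))‖ + ‖z (n + 1) - w n‖ := by
        gcongr; exact norm_add_le _ _
      _ ≤ ‖d (w n)‖ + 2 * δ n := by
        rw [h2, hnε] at h1 ⊢; linarith
  have h2δ : Summable (fun n => 2 * δ n) := herr.mul_left 2
  obtain ⟨ld, hld⟩ := fdr_seqA (u := fun n => ‖d (z n)‖) (fun n => norm_nonneg _)
    (fun n => mul_nonneg zero_le_two (hδ0 n)) h2δ
    (fun n => (hd2 n).trans (add_le_add_left (hd1 n) _))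
  -- bounds
  obtain ⟨Md, hMd⟩ := hld.bddAbove_range
  have hMd' : ∀ n, ‖d (z n)‖ ≤ Md := fun n => hMd ⟨n, rfl⟩
  obtain ⟨Mδ, hMδ⟩ := herr.tendsto_atTop_zero.bddAbove_range
  have hMδ' : ∀ n, δ n ≤ Mδ := fun n => hMδ ⟨n, rfl⟩
  have hMd0 : 0 ≤ Md := (norm_nonneg _).trans (hMd' 0)
  have hMδ0 : 0 ≤ Mδ := (hδ0 0).trans (hMδ' 0)
  have hsq : ∀ zs, d zs = 0 → ∃ M, 0 ≤ M ∧ ∀ n,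
      ‖z (n + 1) - zs‖ ^ 2 ≤ ‖w n - zs‖ ^ 2 + M * δ n := by
    intro zs hzs
    obtain ⟨l, hl⟩ := hconv zs hzs
    obtain ⟨M, hM⟩ := hl.bddAbove_range
    have hM' : ∀ n, ‖z n - zs‖ ≤ M := fun n => hM ⟨n, rfl⟩
    have hM0 : 0 ≤ M := (norm_nonneg _).trans (hM' 0)
    refine ⟨2 * M + Mδ, by positivity, fun n => ?_⟩
    have h1 := pow_le_pow_left₀ (norm_nonneg _) (hfe2 zs n) 2
    have h2 := (hfe1 zs hzs n).trans (hM' n)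
    nlinarith [mul_le_mul_of_nonneg_right h2 (hδ0 n), mul_le_mul_of_nonneg_right (hMδ' n) (hδ0 n)]
  have hdsq : ∀ n, ‖d (z (n + 1))‖ ^ 2 ≤ ‖d (w n)‖ ^ 2 + (4 * Md + 4 * Mδ) * δ n := by
    intro n
    have h1 := pow_le_pow_left₀ (norm_nonneg _) (hd2 n) 2
    have h2 := (hd1 n).trans (hMd' n)
    nlinarith [mul_le_mul_of_nonneg_right h2 (hδ0 n), mul_le_mul_of_nonneg_right (hMδ' n) (hδ0 n)]
  -- residual tends to zero
  have hres : Summable (fun n => lam n * (1 / α - lam n) * ‖d (z n)‖ ^ 2) := by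
    obtain ⟨zs, hzs⟩ := hfix
    obtain ⟨M, hM0, hM⟩ := hsq zs hzs
    refine fdr_seqB (u := fun n => ‖z n - zs‖ ^ 2) (δ := fun n => M * δ n) (fun n => sq_nonneg _)
      (fun n => mul_nonneg hM0 (hδ0 n)) (herr.mul_left M)
      (fun n => mul_nonneg (hll n) (sq_nonneg _)) (fun n => ?_)
    have h1 := hM n
    have h2 := hfe zs hzs n
    linarith
  have hld0 : ld = 0 := by
    by_contra hne0
    have hldp : 0 < ld := lt_of_le_of_ne (ge_of_tendsto' hld fun n => norm_nonneg _) (Ne.symm hne0)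
    apply hdiv
    have hev : ∀ᶠ n in atTop, ld / 2 < ‖d (z n)‖ := hld.eventually (lt_mem_nhds (by linarith))
    have hs := hres.mul_left (α * (4 / ld ^ 2))
    refine Summable.of_norm_bounded_eventually_nat hs ?_
    filter_upwards [hev] with n hn
    have e1 : lam n * (1 - α * lam n) = α * (lam n * (1 / α - lam n)) := by field_simp
    rw [e1, Real.norm_of_nonneg (mul_nonneg hα0.le (hll n))]
    have h1 : 1 ≤ 4 / ld ^ 2 * ‖d (z n)‖ ^ 2 := by
      rw [div_mul_eq_mul_div, le_div_iff₀ (by positivity)]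
      nlinarith
    calc α * (lam n * (1 / α - lam n)) = α * (lam n * (1 / α - lam n)) * 1 := by ring
      _ ≤ α * (lam n * (1 / α - lam n)) * (4 / ld ^ 2 * ‖d (z n)‖ ^ 2) :=
        mul_le_mul_of_nonneg_left h1 (mul_nonneg hα0.le (hll n))
      _ = _ := by ring
  rw [hld0] at hld
  -- weak convergence
  obtain ⟨zb, hzb, hwk⟩ := fdr_opial z {q | d q = 0} hconv hfix (by
    intro U hU q hq
    obtain ⟨zs, hzs⟩ := hfix
    obtain ⟨l, hl⟩ := hconv zs hzs
    obtain ⟨M, hM⟩ := hl.bddAbove_range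
    have hM' : ∀ n, ‖z n - q‖ ≤ M + ‖zs - q‖ := by
      intro n
      have h1 : ‖z n - zs‖ ≤ M := hM ⟨n, rfl⟩
      have h2 := norm_add_le (z n - zs) (zs - q)
      rw [sub_add_sub_cancel] at h2
      linarith
    have hb : ∀ n, ‖d q‖ ^ 2 ≤ 2 * (⟪z n, d q⟫ - ⟪q, d q⟫)
        + ‖d (z n)‖ * (‖d (z n)‖ + 2 * (M + ‖zs - q‖)) := by
      intro n
      have h1 := hT (z n) q
      have h2 : ‖z n - q - d q‖ ≤ ‖z n - q‖ + ‖d (z n)‖ := by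
        have := norm_sub_le ((z n + d (z n)) - (q + d q)) (d (z n))
        rw [show (z n + d (z n)) - (q + d q) - d (z n) = z n - q - d q by abel] at this
        linarith
      have h3 := pow_le_pow_left₀ (norm_nonneg _) h2 2
      rw [norm_sub_sq_real, inner_sub_left] at h3
      nlinarith [mul_le_mul_of_nonneg_left (hM' n) (norm_nonneg (d (z n)))]
    have hlim : Tendsto (fun n => 2 * (⟪z n, d q⟫ - ⟪q, d q⟫)
        + ‖d (z n)‖ * (‖d (z n)‖ + 2 * (M + ‖zs - q‖))) U
        (𝓝 (2 * (⟪q, d q⟫ - ⟪q, d q⟫) + 0 * (0 + 2 * (M + ‖zs - q‖)))) :=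
      (((hq (d q)).sub_const _).const_mul 2).add
        ((hld.mono_left hU).mul ((hld.mono_left hU).add_const _))
    have := ge_of_tendsto' hlim hb
    simp only [sub_self, mul_zero, zero_mul, add_zero] at this
    have : ‖d q‖ = 0 := by nlinarith [norm_nonneg (d q)]
    exact norm_eq_zero.1 this)
  refine ⟨zb, hzb, hwk, ?_, ?_⟩
  · have hb : ∀ n, ‖z (n + 1) - z n‖ ≤ 1 / α * ‖d (z n)‖ + δ n := by
      intro n
      rw [hzw n, show w n + lam n • ε n - z n = lam n • d (z n) + lam n • ε n by simp only [hw]; abel,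
        ← hnε n]
      refine (norm_add_le _ _).trans ?_
      rw [norm_smul (lam n) (d (z n)), Real.norm_of_nonneg (hlam n).1.le]
      gcongr
      exact (hlam n).2.le
    refine squeeze_zero_norm hb ?_
    simpa using (hld.const_mul (1 / α)).add herr.tendsto_atTop_zero
  · obtain ⟨M, hM0, hM⟩ := hsq zb hzb
    refine fdr_seqB (u := fun n => K * (‖z n - zb‖ ^ 2 + ‖d (z n)‖ ^ 2))
      (δ := fun n => K * (M + (4 * Md + 4 * Mδ)) * δ n) (fun n => by positivity)
      (fun n => mul_nonneg (by positivity) (hδ0 n)) (herr.mul_left _)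
      (fun n => mul_nonneg (hlam n).1.le (sq_nonneg _)) (fun n => ?_)
    have h1 := hK (z n) zb (lam n) hzb (hlam n).1 (hlam n).2
    have h2 := hM n
    have h3 := hdsq n
    have h4 := mul_le_mul_of_nonneg_left (add_le_add h2 h3) hK0
    simp only [hw] at h4
    linarith

theorem fdr_subdiff_fin {f : H → EReal} (hfbot : ∀ x, f x ≠ ⊥) (hfproper : ∃ x, f x ≠ ⊤)
    {x u : H} (hu : u ∈ subdiffE f x) : ∃ r : ℝ, f x = (r : EReal) := by
  obtain ⟨y0, hy0⟩ := hfproper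
  have h1 : f x ≠ ⊤ := by
    intro h
    have := hu y0
    rw [h, EReal.coe_add_top, top_le_iff] at this
    exact hy0 this
  exact ⟨(f x).toReal, (EReal.coe_toReal h1 (hfbot x)).symm⟩

theorem fdr_subdiff_mono {f : H → EReal} (hfbot : ∀ x, f x ≠ ⊥) (hfproper : ∃ x, f x ≠ ⊤)
    {x y u v : H} (hu : u ∈ subdiffE f x) (hv : v ∈ subdiffE f y) : 0 ≤ ⟪x - y, u - v⟫ := by
  obtain ⟨r, hr⟩ := fdr_subdiff_fin hfbot hfproper hu
  obtain ⟨q, hq⟩ := fdr_subdiff_fin hfbot hfproper hv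
  have h1 := hu y
  have h2 := hv x
  rw [hr, hq] at h1 h2
  norm_cast at h1 h2
  rw [inner_sub_right]
  rw [← neg_sub x y, inner_neg_left] at h1
  linarith

theorem fdr_prox_firm {f : H → EReal} (hfbot : ∀ x, f x ≠ ⊥) (hfproper : ∃ x, f x ≠ ⊤)
    {γ : ℝ} (hγ : 0 < γ) {prox : H → H}
    (hprox : ∀ w q : H, prox w = q ↔ ∃ u ∈ subdiffE f q, w - q = γ • u) (s r : H) :
    0 ≤ ⟪(s - prox s) - (r - prox r), prox s - prox r⟫ := by
  obtain ⟨u, hu, hu'⟩ := (hprox s (prox s)).1 rfl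
  obtain ⟨v, hv, hv'⟩ := (hprox r (prox r)).1 rfl
  have := fdr_subdiff_mono hfbot hfproper hu hv
  rw [hu', hv', ← smul_sub, inner_smul_left, real_inner_comm]
  exact mul_nonneg (by simpa using hγ.le) this

theorem fdr_prox_ne {f : H → EReal} (hfbot : ∀ x, f x ≠ ⊥) (hfproper : ∃ x, f x ≠ ⊤)
    {γ : ℝ} (hγ : 0 < γ) {prox : H → H}
    (hprox : ∀ w q : H, prox w = q ↔ ∃ u ∈ subdiffE f q, w - q = γ • u) (s r : H) :
    ‖prox s - prox r‖ ≤ ‖s - r‖ := by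
  have h := fdr_prox_firm hfbot hfproper hγ hprox s r
  rw [show (s - prox s) - (r - prox r) = (s - r) - (prox s - prox r) by abel, inner_sub_left,
    real_inner_self_eq_norm_sq] at h
  have h2 := real_inner_le_norm (s - r) (prox s - prox r)
  rcases (norm_nonneg (prox s - prox r)).eq_or_lt with h0 | h0
  · rw [← h0]; positivity
  · exact le_of_mul_le_mul_right (by nlinarith) h0

theorem fdr_proj (V : Submodule ℝ H) (hV : IsClosed (V : Set H))
    (P : H → H) (hP : ∀ x : H, P x ∈ V ∧ x - P x ∈ Vᗮ) :
    ∃ Q : H →L[ℝ] H, (∀ x, P x = Q x) ∧ (∀ x, ‖Q x‖ ≤ ‖x‖) ∧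
      (∀ x y, ⟪Q x, y⟫ = ⟪Q x, Q y⟫) ∧ (∀ x ∈ V, Q x = x) ∧ (∀ x ∈ Vᗮ, Q x = 0) := by
  haveI : CompleteSpace V := hV.completeSpace_coe
  have hPQ : ∀ x, P x = V.starProjection x := by
    intro x
    exact (Submodule.eq_starProjection_of_mem_orthogonal (hP x).1 (hP x).2).symm
  refine ⟨V.starProjection, hPQ, fun x => V.norm_starProjection_apply_le x, fun x y => ?_, 
    fun x hx => Submodule.starProjection_eq_self_iff.2 hx, fun x hx => ?_⟩
  · rw [← hPQ, ← hPQ]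
    have := Submodule.inner_right_of_mem_orthogonal (hP x).1 (hP y).2
    rw [inner_sub_right] at this
    linarith
  · rw [← hPQ]
    have h1 : P x ∈ Vᗮ := by
      have := Vᗮ.sub_mem hx (hP x).2
      simpa using this
    have := Submodule.inner_right_of_mem_orthogonal (hP x).1 h1
    exact inner_self_eq_zero.1 this

theorem statement19
    (V : Submodule ℝ H) (hV : IsClosed (V : Set H))
    (P : H → H) (hP : ∀ x : H, P x ∈ V ∧ x - P x ∈ Vᗮ)
    (f : H → EReal)
    (hfconv : ∀ x y : H, ∀ a b : ℝ, 0 ≤ a → 0 ≤ b → a + b = 1 →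
      f (a • x + b • y) ≤ (a : EReal) * f x + (b : EReal) * f y)
    (hflsc : LowerSemicontinuous f)
    (hfbot : ∀ x, f x ≠ ⊥) (hfproper : ∃ x, f x ≠ ⊤)
    (g : H → ℝ) (g' : H → H)
    (hg : ∀ x, HasGradientAt g (g' x) x)
    (hgconv : ConvexOn ℝ Set.univ g)
    (β : ℝ) (hβ : 0 < β)
    (hLip : ∀ x y : H, ‖g' x - g' y‖ ≤ (1 / β) * ‖x - y‖)
    (hzer : ∃ w : H, ∃ u ∈ subdiffE f w, ∃ v ∈ normalConeSub V w, u + g' w + v = 0)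
    (γ : ℝ) (hγ : γ ∈ Set.Ioo (0 : ℝ) (2 * β))
    (α : ℝ) (hα : α = max (2 / 3) (2 * γ / (γ + 2 * β)))
    (lam : ℕ → ℝ) (hlam : ∀ n, lam n ∈ Set.Ioo (0 : ℝ) (1 / α))
    (a b : ℕ → H)
    (hdiv : ¬ Summable (fun n => lam n * (1 - α * lam n)))
    (herr : Summable (fun n => lam n * (‖a n‖ + ‖b n‖)))
    (prox : H → H)
    (hprox : ∀ w q : H, prox w = q ↔ ∃ u ∈ subdiffE f q, w - q = γ • u)
    (z x y s p : ℕ → H)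
    (hx : ∀ n, x n = P (z n))
    (hy : ∀ n, y n = γ⁻¹ • (x n - z n))
    (hs : ∀ n, s n = x n - γ • P (g' (x n) + a n) + γ • y n)
    (hp : ∀ n, p n = prox (s n) + b n)
    (hz : ∀ n, z (n + 1) = z n + lam n • (p n - x n)) :
    (∀ n, x n ∈ V ∧ y n ∈ Vᗮ) ∧
    ∃ xbar : H,
      (xbar ∈ V ∧ ∀ w ∈ V, f xbar + (g xbar : EReal) ≤ f w + (g w : EReal)) ∧
      (∃ u ∈ subdiffE f xbar, ∃ v ∈ normalConeSub V xbar, u + g' xbar + v = 0) ∧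
      ∃ ybar : H, ybar ∈ Vᗮ ∧ (∃ u ∈ subdiffE f xbar, ybar = u + P (g' xbar)) ∧
        WeakLim x xbar ∧ WeakLim y ybar ∧
        Tendsto (fun n => x (n + 1) - x n) atTop (nhds 0) ∧
        Tendsto (fun n => y (n + 1) - y n) atTop (nhds 0) ∧
        Summable (fun n => lam n * ‖P (g' (x n) - g' xbar)‖ ^ 2) := by
  obtain ⟨hγ0, hγ1⟩ := hγ
  obtain ⟨Q, hPQ, hQn, hQi, hQV, hQo⟩ := fdr_proj V hV P hP
  have hQm : ∀ x, Q x ∈ V := fun x => hPQ x ▸ (hP x).1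
  have hQm' : ∀ x, x - Q x ∈ Vᗮ := fun x => hPQ x ▸ (hP x).2
  have horth : ∀ u v, ⟪Q u, v - Q v⟫ = 0 := fun u v =>
    Submodule.inner_right_of_mem_orthogonal (hQm u) (hQm' v)
  simp only [hPQ] at hx hs ⊢
  set t : ℝ := γ / (2 * β) with ht
  have ht0 : 0 < t := by positivity
  have ht1 : t < 1 := by rw [ht, div_lt_one (by positivity)]; exact hγ1
  have hαt : α = max (2 / 3) (2 * t / (1 + t)) := by
    rw [hα, ht]; congr 1; field_simp; ring
  let C : H → H := fun z => γ • Q (g' (Q z))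
  let G : H → ℝ := fun z => γ * g (Q z)
  let d : H → H := fun z => prox ((2 : ℝ) • Q z - z - C z) - Q z
  have hCin : ∀ v u, ⟪C v, u⟫ = γ * ⟪g' (Q v), Q u⟫ := by
    intro v u
    simp only [C]
    rw [inner_smul_left, hQi, real_inner_comm, ← hQi u, real_inner_comm]
    simp
  have hG1 : ∀ u v, G v + ⟪C v, u - v⟫ + 1 / (4 * t) * ‖C u - C v‖ ^ 2 ≤ G u := by
    intro u v
    have h := mul_le_mul_of_nonneg_left (fdr_bh hg hgconv β hβ hLip (Q u) (Q v)) hγ0.le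
    have h1 : ‖C u - C v‖ ≤ γ * ‖g' (Q u) - g' (Q v)‖ := by
      simp only [C]
      rw [← smul_sub, ← map_sub, norm_smul, Real.norm_of_nonneg hγ0.le]
      exact mul_le_mul_of_nonneg_left (hQn _) hγ0.le
    have h2 : 1 / (4 * t) * ‖C u - C v‖ ^ 2 ≤
        1 / (4 * t) * (γ * ‖g' (Q u) - g' (Q v)‖) ^ 2 := by gcongr
    have h3 : 1 / (4 * t) * (γ * ‖g' (Q u) - g' (Q v)‖) ^ 2 =
        γ * (β / 2 * ‖g' (Q u) - g' (Q v)‖ ^ 2) := by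
      rw [ht]; field_simp; norm_num
    rw [hCin, map_sub]
    simp only [G]
    linarith
  have hG2 : ∀ u v, G u ≤ G v + ⟪C v, u - v⟫ + t * ‖u - v‖ ^ 2 := by
    intro u v
    have h := mul_le_mul_of_nonneg_left (fdr_descent hg (1 / β) hLip (Q u) (Q v)) hγ0.le
    have h1 : ‖Q u - Q v‖ ≤ ‖u - v‖ := by rw [← map_sub]; exact hQn _
    have h2 : t * ‖Q u - Q v‖ ^ 2 ≤ t * ‖u - v‖ ^ 2 := by gcongr
    have h3 : γ * (1 / β / 2 * ‖Q u - Q v‖ ^ 2) = t * ‖Q u - Q v‖ ^ 2 := by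
      rw [ht]; field_simp
    rw [hCin, map_sub]
    simp only [G]
    linarith
  have hF : ∀ u v, 0 ≤ ⟪-(d u - d v) - (C u - C v), (u - v) + (d u - d v)⟫ := by
    intro u v
    have h := fdr_prox_firm hfbot hfproper hγ0 hprox ((2 : ℝ) • Q u - u - C u)
      ((2 : ℝ) • Q v - v - C v)
    set q := prox ((2 : ℝ) • Q u - u - C u) - prox ((2 : ℝ) • Q v - v - C v) with hq
    set p' := Q (u - v) with hp'
    set r := (u - v) - Q (u - v) with hr
    set c := C u - C v with hc
    have e1 : (2 : ℝ) • Q u - u - C u - prox ((2 : ℝ) • Q u - u - C u) -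
        ((2 : ℝ) • Q v - v - C v - prox ((2 : ℝ) • Q v - v - C v)) = (p' - c - q) - r := by
      rw [hp', hc, hq, hr, map_sub]; module
    have e2 : d u - d v = q - p' := by
      simp only [d]; rw [hq, hp', map_sub]; abel
    have e3 : -(d u - d v) - c = p' - c - q := by rw [e2]; abel
    have e4 : (u - v) + (d u - d v) = q + r := by rw [e2, hr, ← hp']; abel
    rw [e1, inner_sub_left] at h
    rw [e3, e4, inner_add_right]
    have o1 : ⟪p', r⟫ = 0 := horth _ _
    have o2 : ⟪c, r⟫ = 0 := by
      rw [hc]; simp only [C]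
      rw [← smul_sub, ← map_sub, inner_smul_left, hr, horth, mul_zero]
    have o3 : ⟪p' - c - q, r⟫ = - ⟪r, q⟫ := by
      rw [inner_sub_left, inner_sub_left, o1, o2, real_inner_comm]; ring
    rw [o3]
    linarith
  have hfix : ∃ zs, d zs = 0 := by
    obtain ⟨w, u, hu, v, ⟨hwV, hvV⟩, huv⟩ := hzer
    have hy' : u + Q (g' w) ∈ Vᗮ := by
      have h1 : u + Q (g' w) = -v - (g' w - Q (g' w)) := by
        have : u = - v - g' w := by
          rw [eq_sub_iff_add_eq, eq_neg_iff_add_eq_zero]; exact huv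
        rw [this]; abel
      rw [h1]
      exact Vᗮ.sub_mem (Vᗮ.neg_mem hvV) (hQm' _)
    refine ⟨w - γ • (u + Q (g' w)), ?_⟩
    have hQz : Q (w - γ • (u + Q (g' w))) = w := by
      rw [map_sub, map_smul, hQV w hwV, hQo _ hy', smul_zero, sub_zero]
    simp only [d, C]
    rw [hQz, sub_eq_zero, hprox]
    exact ⟨u, hu, by module⟩
  let ε : ℕ → H := fun n => prox (s n) + b n - prox ((2 : ℝ) • Q (z n) - z n - C (z n))
  have hε : ∀ n, ‖ε n‖ ≤ (γ + 1) * (‖a n‖ + ‖b n‖) := by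
    intro n
    have h1 := fdr_prox_ne hfbot hfproper hγ0 hprox (s n) ((2 : ℝ) • Q (z n) - z n - C (z n))
    have h2 : s n - ((2 : ℝ) • Q (z n) - z n - C (z n)) = - (γ • Q (a n)) := by
      simp only [C]
      rw [hs n, hy n, smul_smul, mul_inv_cancel₀ hγ0.ne', one_smul, hx n, map_add]
      module
    rw [h2, norm_neg, norm_smul, Real.norm_of_nonneg hγ0.le] at h1
    have h3 : ε n = (prox (s n) - prox ((2 : ℝ) • Q (z n) - z n - C (z n))) + b n := by
      simp only [ε]; abel
    rw [h3]
    refine (norm_add_le _ _).trans ?_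
    have h4 := mul_le_mul_of_nonneg_left (hQn (a n)) hγ0.le
    nlinarith [norm_nonneg (a n), norm_nonneg (b n), mul_nonneg hγ0.le (norm_nonneg (b n))]
  have herr' : Summable (fun n => lam n * ‖ε n‖) := by
    refine Summable.of_nonneg_of_le (fun n => mul_nonneg (hlam n).1.le (norm_nonneg _)) (fun n => ?_)
      (herr.mul_left (γ + 1))
    have := mul_le_mul_of_nonneg_left (hε n) (hlam n).1.le
    linarith
  have hz' : ∀ n, z (n + 1) = z n + lam n • (d (z n) + ε n) := by
    intro n
    rw [hz n, hp n, hx n]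
    simp only [d, ε]
    congr 2
    abel
  obtain ⟨zb, hzb, hwk, hdz, hsum⟩ := fdr_main ht0 ht1 hαt hF hG1 hG2 hfix lam hlam hdiv ε z herr' hz'
  have hQself : ∀ u v, ⟪Q u, v⟫ = ⟪u, Q v⟫ := by
    intro u v
    rw [hQi, real_inner_comm, ← hQi v, real_inner_comm]
  refine ⟨fun n => ⟨hx n ▸ hQm _, ?_⟩, Q zb, ?_⟩
  · rw [hy n, hx n, ← neg_sub]
    exact Vᗮ.smul_mem _ (Vᗮ.neg_mem (hQm' _))
  have hzb' : prox ((2 : ℝ) • Q zb - zb - C zb) = Q zb := sub_eq_zero.1 hzb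
  obtain ⟨u, hu, hu'⟩ := (hprox _ _).1 hzb'
  have hyb : γ⁻¹ • (Q zb - zb) = u + Q (g' (Q zb)) := by
    have h1 : Q zb - zb = γ • (u + Q (g' (Q zb))) := by
      rw [smul_add, ← hu']
      simp only [C]
      module
    rw [h1, smul_smul, inv_mul_cancel₀ hγ0.ne', one_smul]
  have hybo : γ⁻¹ • (Q zb - zb) ∈ Vᗮ := by
    rw [← neg_sub]
    exact Vᗮ.smul_mem _ (Vᗮ.neg_mem (hQm' _))
  have hvo : -(u + g' (Q zb)) ∈ Vᗮ := by
    have h1 : -(u + g' (Q zb)) = -(u + Q (g' (Q zb))) - (g' (Q zb) - Q (g' (Q zb))) := by abel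
    rw [h1, ← hyb]
    exact Vᗮ.sub_mem (Vᗮ.neg_mem hybo) (hQm' _)
  have hwx : WeakLim x (Q zb) := by
    intro v
    simp only [hx, hQself]
    exact hwk (Q v)
  refine ⟨⟨hQm _, fun w hw => ?_⟩, ⟨u, hu, _, ⟨hQm _, hvo⟩, by abel⟩, γ⁻¹ • (Q zb - zb), hybo,
    ⟨u, hu, hyb⟩, hwx, ?_, ?_, ?_, ?_⟩
  · obtain ⟨r, hr⟩ := fdr_subdiff_fin hfbot hfproper hu
    have h1 := hu w
    have h2 := fdr_first_order hg hgconv w (Q zb)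
    have h3 := Submodule.inner_right_of_mem_orthogonal (V.sub_mem hw (hQm zb)) hvo
    rw [inner_neg_right, inner_add_right, real_inner_comm] at h3
    have h4 : r + g (Q zb) ≤ (⟪w - Q zb, u⟫ + r) + g w := by
      rw [real_inner_comm] at h2 h3
      linarith
    rw [hr] at h1 ⊢
    calc (r : EReal) + (g (Q zb) : EReal) ≤ ((⟪w - Q zb, u⟫ : ℝ) : EReal) + r + g w := by
          exact_mod_cast h4
      _ ≤ f w + g w := add_le_add_left h1 _
  · intro v
    simp only [hy, inner_smul_left, inner_sub_left]
    exact ((hwx v).sub (hwk v)).const_mul _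
  · have h := (Q.continuous.tendsto 0).comp hdz
    simpa [Function.comp_def, hx] using h
  · have h := (Q.continuous.tendsto 0).comp hdz
    have h1 := (h.sub hdz).const_smul γ⁻¹
    simp only [map_zero, sub_zero, smul_zero] at h1
    refine h1.congr fun n => ?_
    simp only [Function.comp_def, hy, hx, map_sub]
    module
  · have h := hsum.mul_left (γ⁻¹ ^ 2)
    refine h.congr fun n => ?_
    simp only [C]
    rw [← smul_sub, ← map_sub, norm_smul, Real.norm_of_nonneg hγ0.le, hx n]
    field_simp
end
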